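/- arXiv:2406.17544 — 2 statements merged into one kernel-verified Lean document; each statement's English description precedes it below -/
import Mathlib

section
/- Let k > 1 and 0 < δ < 1 be real numbers. There is a constant C = C(k,δ) > 0 such that for all X ≥ 2: (i) for every τ > 0, ∫_{−τ}^{τ} |S_k(α)|² dα ≤ C (τ X^{1/k} + X^{2/k−1}) (log X)³; and (ii) for every integer n, ∫_n^{n+1} |S_k(α)|² dα ≤ C X^{1/k} (log X)³. -/
open scoped Classical
open MeasureTheory

noncomputable section

/-- `e x = exp(2πix)` -/
def e (x : ℝ) : ℂ := Complex.exp (2 * Real.pi * Complex.I * x)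

/-- The exponential sum `S_k(α)` over primes `p` with `δX ≤ p^k ≤ X`. -/
def S (k δ X α : ℝ) : ℂ :=
  ∑ p ∈ (Finset.range (⌈X⌉₊ + 1)).filter
      (fun p : ℕ => p.Prime ∧ δ * X ≤ (p : ℝ) ^ k ∧ (p : ℝ) ^ k ≤ X),
    (Real.log p : ℂ) * e ((p : ℝ) ^ k * α)

/-- The exponential sum `U_k(α)` over naturals `n` with `δX ≤ n^k ≤ X`. -/
def U (k δ X α : ℝ) : ℂ :=
  ∑ n ∈ (Finset.range (⌈X⌉₊ + 1)).filter
      (fun n : ℕ => δ * X ≤ (n : ℝ) ^ k ∧ (n : ℝ) ^ k ≤ X),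
    e ((n : ℝ) ^ k * α)

/-- The exponential integral `T_k(α)`. -/
def T (k δ X α : ℝ) : ℂ :=
  ∫ t in (δ * X) ^ (1 / k)..(X ^ (1 / k)), e (α * t ^ k)

/-- Chebyshev theta function. -/
def theta (x : ℝ) : ℝ :=
  ∑ p ∈ (Finset.range (⌊x⌋₊ + 1)).filter Nat.Prime, Real.log p

/-- The generalized Selberg integral `𝒥_k(X,h)`. -/
def selbergJ (k X h : ℝ) : ℝ :=
  ∫ x in X..(2 * X),
    (theta ((x + h) ^ (1 / k)) - theta (x ^ (1 / k)) -
      ((x + h) ^ (1 / k) - x ^ (1 / k))) ^ 2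

/-- `ψ(m,z) = 1` iff every prime factor of `m` is at least `z`. -/
def psi (m : ℕ) (z : ℝ) : ℝ :=
  if ∀ p : ℕ, p.Prime → p ∣ m → z ≤ (p : ℝ) then 1 else 0

/-- The function `z(p)` of Harman–Kumchev. -/
def zfun (X : ℝ) (p : ℕ) : ℝ :=
  if (p : ℝ) < X ^ ((1 : ℝ) / 7) then X ^ ((5 : ℝ) / 28) * (p : ℝ) ^ (-(1 : ℝ) / 2)
  else if (p : ℝ) ≤ X ^ ((3 : ℝ) / 14) then (p : ℝ)
  else X ^ ((5 : ℝ) / 14) * (p : ℝ)⁻¹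

/-- The Harman–Kumchev sieve weight `ρ(m)`. -/
def rho (X : ℝ) (m : ℕ) : ℝ :=
  psi m (X ^ ((5 : ℝ) / 42)) -
    ∑ p ∈ (Finset.range (⌈X ^ ((1 : ℝ) / 4)⌉₊ + 1)).filter
        (fun p : ℕ => p.Prime ∧ X ^ ((5 : ℝ) / 42) ≤ (p : ℝ) ∧ (p : ℝ) < X ^ ((1 : ℝ) / 4) ∧ p ∣ m),
      psi (m / p) (zfun X p)

/-- The sieved exponential sum `S̃_2(α)`. -/
def Stilde (δ X α : ℝ) : ℂ :=
  ∑ m ∈ (Finset.range (⌈X⌉₊ + 1)).filter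
      (fun m : ℕ => δ * X ≤ (m : ℝ) ^ 2 ∧ (m : ℝ) ^ 2 ≤ X),
    (rho X m : ℂ) * e ((m : ℝ) ^ 2 * α)

/-- The Fejér-type kernel `K_η(α)`. -/
def Kf (η α : ℝ) : ℝ :=
  if α = 0 then η ^ 2 else (Real.sin (Real.pi * α * η) / (Real.pi * α)) ^ 2


lemma norm_integral_e_le (a b : ℝ) {μ : ℝ} (hμ : μ ≠ 0) :
    ‖∫ α in a..b, e (μ * α)‖ ≤ |μ|⁻¹ := by
  have hc : (2 * Real.pi * Complex.I * μ : ℂ) ≠ 0 := by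
    simp [Real.pi_ne_zero, hμ]
  have h1 : ∀ α : ℝ, e (μ * α) = Complex.exp ((2 * Real.pi * Complex.I * μ) * α) := by
    intro α
    simp only [e]
    push_cast
    ring_nf
  have h2 : ∀ α : ℝ, ‖Complex.exp ((2 * Real.pi * Complex.I * μ) * α)‖ = 1 := by
    intro α
    rw [show (2 * Real.pi * Complex.I * μ : ℂ) * α = ((2 * Real.pi * μ * α : ℝ) : ℂ) * Complex.I by
      push_cast; ring]
    exact Complex.norm_exp_ofReal_mul_I _
  simp_rw [h1]
  rw [integral_exp_mul_complex hc, norm_div]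
  have h3 : ‖(2 * Real.pi * Complex.I * μ : ℂ)‖ = 2 * Real.pi * |μ| := by
    simp [abs_of_pos Real.pi_pos]
  have h4 : ‖Complex.exp ((2 * Real.pi * Complex.I * μ) * b) -
      Complex.exp ((2 * Real.pi * Complex.I * μ) * a)‖ ≤ 2 := by
    refine (norm_sub_le _ _).trans ?_
    rw [h2, h2]
    norm_num
  have hμ' : 0 < |μ| := abs_pos.mpr hμ
  rw [h3, div_le_iff₀ (by positivity)]
  calc _ ≤ (2 : ℝ) := h4
    _ ≤ 2 * Real.pi := by linarith [Real.pi_gt_three]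
    _ = |μ|⁻¹ * (2 * Real.pi * |μ|) := by field_simp

lemma continuous_e : Continuous e := by
  unfold e
  fun_prop

lemma e_mul_conj (x y : ℝ) : e x * (starRingEnd ℂ) (e y) = e (x - y) := by
  simp only [e, ← Complex.exp_conj, ← Complex.exp_add]
  congr 1
  simp [Complex.conj_ofNat]
  ring

/-- The mean square of an exponential sum, expanded and estimated termwise. -/
lemma integral_normSq_sum_le {ι : Type*} (s : Finset ι) (c l : ι → ℝ) (hc : ∀ i ∈ s, 0 ≤ c i)
    (a b : ℝ) :
    (∫ α in a..b, ‖∑ i ∈ s, (c i : ℂ) * e (l i * α)‖ ^ 2) ≤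
      ∑ i ∈ s, ∑ j ∈ s, c i * c j * ‖∫ α in a..b, e ((l i - l j) * α)‖ := by
  have h1 : ∀ α : ℝ, ((‖∑ i ∈ s, (c i : ℂ) * e (l i * α)‖ ^ 2 : ℝ) : ℂ) =
      ∑ i ∈ s, ∑ j ∈ s, ((c i * c j : ℝ) : ℂ) * e ((l i - l j) * α) := by
    intro α
    push_cast
    rw [← Complex.mul_conj', map_sum, Finset.sum_mul_sum]
    refine Finset.sum_congr rfl fun i _ => Finset.sum_congr rfl fun j _ => ?_
    rw [sub_mul, ← e_mul_conj, map_mul, Complex.conj_ofReal]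
    ring
  have hcont : ∀ i j, Continuous fun α : ℝ => ((c i * c j : ℝ) : ℂ) * e ((l i - l j) * α) :=
    fun i j => continuous_const.mul (continuous_e.comp (by fun_prop))
  have h2 : ((∫ α in a..b, ‖∑ i ∈ s, (c i : ℂ) * e (l i * α)‖ ^ 2 : ℝ) : ℂ) =
      ∑ i ∈ s, ∑ j ∈ s, ((c i * c j : ℝ) : ℂ) * ∫ α in a..b, e ((l i - l j) * α) := by
    rw [← intervalIntegral.integral_ofReal]
    simp_rw [h1]
    rw [intervalIntegral.integral_finsetSum fun i _ =>
      (continuous_finsetSum s fun j _ => hcont i j).intervalIntegrable _ _]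
    refine Finset.sum_congr rfl fun i _ => ?_
    rw [intervalIntegral.integral_finsetSum fun j _ => (hcont i j).intervalIntegrable _ _]
    refine Finset.sum_congr rfl fun j _ => ?_
    rw [intervalIntegral.integral_const_mul]
  refine (le_abs_self _).trans ?_
  rw [← Real.norm_eq_abs, ← Complex.norm_real, h2]
  refine (norm_sum_le _ _).trans (Finset.sum_le_sum fun i hi => ?_)
  refine (norm_sum_le _ _).trans (Finset.sum_le_sum fun j hj => ?_)
  rw [norm_mul, Complex.norm_real, Real.norm_of_nonneg (mul_nonneg (hc i hi) (hc j hj))]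

lemma sum_inv_abs_sub_le {p M : ℕ} (hp : p ≤ M) :
    ∑ q ∈ Finset.range (M + 1), |(p : ℝ) - q|⁻¹ ≤ 2 * (1 + Real.log M) := by
  have hH : ∑ i ∈ Finset.range (M + 1), (i : ℝ)⁻¹ ≤ 1 + Real.log M := by
    refine le_trans (le_of_eq ?_) (harmonic_le_one_add_log M)
    rw [Finset.sum_range_succ']
    simp [harmonic]
  have hmono : ∀ m ≤ M + 1, ∑ i ∈ Finset.range m, (i : ℝ)⁻¹ ≤ 1 + Real.log M := fun m hm =>
    (Finset.sum_le_sum_of_subset_of_nonneg (Finset.range_mono hm)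
      fun i _ _ => by positivity).trans hH
  rw [Finset.range_eq_Ico, ← Finset.sum_Ico_consecutive _ (Nat.zero_le p) (by omega),
    Finset.sum_Ico_eq_sum_range _ p, ← Finset.range_eq_Ico]
  have h1 : ∑ q ∈ Finset.range p, |(p : ℝ) - q|⁻¹ ≤ 1 + Real.log M := by
    refine le_trans (le_of_eq ?_) (hmono (p + 1) (by omega))
    rw [Finset.sum_range_succ', ← Finset.sum_range_reflect]
    simp only [Nat.cast_zero, inv_zero, add_zero]
    refine Finset.sum_congr rfl fun j hj => ?_
    have hj' := Finset.mem_range.mp hj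
    have h : ((p - 1 - j : ℕ) : ℝ) = p - 1 - j := by
      rw [Nat.cast_sub (by omega), Nat.cast_sub (by omega)]
      simp
    rw [h, show (p : ℝ) - (p - 1 - j) = ((j + 1 : ℕ) : ℝ) by push_cast; ring, Nat.abs_cast]
  have h2 : ∑ i ∈ Finset.range (M + 1 - p), |(p : ℝ) - ((p + i : ℕ) : ℝ)|⁻¹ ≤
      1 + Real.log M := by
    refine le_trans (le_of_eq ?_) (hmono (M + 1 - p) (by omega))
    refine Finset.sum_congr rfl fun i _ => ?_
    push_cast
    rw [sub_add_cancel_left, abs_neg, Nat.abs_cast]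
  linarith

lemma mul_abs_sub_le_abs_rpow_sub {k A x y : ℝ} (hk : 1 < k) (hx : 0 < x) (hy : 0 < y)
    (hxA : A ≤ x ^ (k - 1)) (hyA : A ≤ y ^ (k - 1)) :
    A * |x - y| ≤ |x ^ k - y ^ k| := by
  wlog h : y ≤ x generalizing x y
  · rw [abs_sub_comm x, abs_sub_comm (x ^ k)]
    exact this hy hx hyA hxA (le_of_not_ge h)
  have e1 : ∀ z : ℝ, 0 < z → z ^ k = z ^ (k - 1) * z := fun z hz => by
    rw [Real.rpow_sub_one hz.ne', div_mul_cancel₀ _ hz.ne']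
  have h1 : y ^ (k - 1) ≤ x ^ (k - 1) := Real.rpow_le_rpow hy.le h (by linarith)
  have h2 : A * (x - y) ≤ x ^ k - y ^ k := by
    rw [e1 x hx, e1 y hy]
    nlinarith [mul_le_mul_of_nonneg_right hyA (sub_nonneg.mpr h),
      mul_le_mul_of_nonneg_right h1 hx.le]
  rw [abs_of_nonneg (sub_nonneg.mpr h)]
  exact h2.trans (le_abs_self _)

lemma integral_normSq_S_le {k δ X a b : ℝ} (hk : 1 < k) (hδ0 : 0 < δ) (hX : 2 ≤ X)
    (hab : a ≤ b) :
    (∫ α in a..b, ‖S k δ X α‖ ^ 2) ≤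
      (2 + 6 / δ) * ((b - a) * X ^ (1 / k) + X ^ (2 / k - 1)) * (Real.log X) ^ 3 := by
  have hX0 : 0 < X := by linarith
  have hk0 : 0 < k := by linarith
  set N := X ^ (1 / k) with hN
  have hN0 : 0 < N := Real.rpow_pos_of_pos hX0 _
  have hNX : X ^ (2 / k - 1) = N ^ 2 / X := by
    rw [Real.rpow_sub_one hX0.ne', hN, ← Real.rpow_natCast, ← Real.rpow_mul hX0.le]
    congr 2
    push_cast
    ring
  set L := Real.log X with hL
  have hL2 : 1 / 2 < L := by
    have := Real.log_le_log (by norm_num) hX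
    linarith [Real.log_two_gt_d9]
  set M := ⌊N⌋₊ with hM
  set s := (Finset.range (⌈X⌉₊ + 1)).filter
      (fun p : ℕ => p.Prime ∧ δ * X ≤ (p : ℝ) ^ k ∧ (p : ℝ) ^ k ≤ X) with hs
  have hsN : ∀ p ∈ s, (p : ℝ) ≤ N := by
    intro p hp
    have h := (Finset.mem_filter.mp hp).2.2.2
    rw [hN, one_div]
    exact (Real.le_rpow_inv_iff_of_pos (Nat.cast_nonneg p) hX0.le hk0).mpr h
  have hp1 : ∀ p ∈ s, (1 : ℝ) ≤ p := fun p hp => by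
    exact_mod_cast (Finset.mem_filter.mp hp).2.1.one_le
  have hNleX : N ≤ X := by
    rw [hN]
    refine (Real.rpow_le_rpow_of_exponent_le (by linarith) ?_).trans_eq (Real.rpow_one X)
    rw [div_le_one hk0]
    exact hk.le
  have hsM : ∀ p ∈ s, p ≤ M := fun p hp => Nat.le_floor (hsN p hp)
  have hsA : ∀ p ∈ s, δ * X / N ≤ (p : ℝ) ^ (k - 1) := by
    intro p hp
    have h1 := hp1 p hp
    rw [Real.rpow_sub_one (by linarith)]
    have h2 := (Finset.mem_filter.mp hp).2.2.1
    exact div_le_div₀ (by positivity) h2 (by linarith) (hsN p hp)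
  have hlog : ∀ p ∈ s, Real.log p ≤ L := fun p hp =>
    Real.log_le_log (by linarith [hp1 p hp]) ((hsN p hp).trans hNleX)
  have hlog0 : ∀ p ∈ s, 0 ≤ Real.log p := fun p hp => Real.log_nonneg (hp1 p hp)
  have hcard : (s.card : ℝ) ≤ N := by
    have hsub : s ⊆ Finset.Icc 1 M := fun p hp =>
      Finset.mem_Icc.mpr ⟨by exact_mod_cast hp1 p hp, hsM p hp⟩
    have h1 : s.card ≤ M := (Finset.card_le_card hsub).trans_eq (by simp)
    exact (Nat.cast_le.mpr h1).trans (Nat.floor_le hN0.le)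
  have hpair : ∀ p ∈ s, ∀ q ∈ s, ‖∫ α in a..b, e (((p : ℝ) ^ k - (q : ℝ) ^ k) * α)‖ ≤
      (if p = q then b - a else 0) + N / (δ * X) * |(p : ℝ) - q|⁻¹ := by
    intro p hp q hq
    by_cases hpq : p = q
    · subst hpq
      have h := Complex.norm_of_nonneg (sub_nonneg.mpr hab)
      push_cast at h
      simp [e, h]
    · have hd : 0 < |(p : ℝ) - q| := abs_pos.mpr (sub_ne_zero.mpr (by exact_mod_cast hpq))
      have h1 := mul_abs_sub_le_abs_rpow_sub hk (by linarith [hp1 p hp]) (by linarith [hp1 q hq])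
        (hsA p hp) (hsA q hq)
      have h2 : 0 < δ * X / N * |(p : ℝ) - q| := by positivity
      rw [if_neg hpq, zero_add]
      refine (norm_integral_e_le a b (abs_pos.mp (h2.trans_le h1))).trans ?_
      refine (inv_anti₀ h2 h1).trans_eq ?_
      rw [mul_inv, inv_div]
  have hrow : ∀ p ∈ s, ∑ q ∈ s, |(p : ℝ) - q|⁻¹ ≤ 6 * L := by
    intro p hp
    have h1 : ∑ q ∈ s, |(p : ℝ) - q|⁻¹ ≤ ∑ q ∈ Finset.range (M + 1), |(p : ℝ) - q|⁻¹ :=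
      Finset.sum_le_sum_of_subset_of_nonneg
        (fun q hq => Finset.mem_range.mpr (Nat.lt_succ_of_le (hsM q hq)))
        fun _ _ _ => by positivity
    have h2 : Real.log M ≤ L := by
      have hM1 : (1 : ℝ) ≤ M := (hp1 p hp).trans (by exact_mod_cast hsM p hp)
      exact Real.log_le_log (by linarith) ((Nat.floor_le hN0.le).trans hNleX)
    linarith [sum_inv_abs_sub_le (hsM p hp)]
  calc (∫ α in a..b, ‖S k δ X α‖ ^ 2)
      ≤ ∑ p ∈ s, ∑ q ∈ s, Real.log p * Real.log q *
          ‖∫ α in a..b, e (((p : ℝ) ^ k - (q : ℝ) ^ k) * α)‖ :=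
        integral_normSq_sum_le s (fun p => Real.log p) (fun p => (p : ℝ) ^ k) hlog0 a b
    _ ≤ ∑ p ∈ s, ∑ q ∈ s, L * L *
          ((if p = q then b - a else 0) + N / (δ * X) * |(p : ℝ) - q|⁻¹) := by
        refine Finset.sum_le_sum fun p hp => Finset.sum_le_sum fun q hq => ?_
        exact mul_le_mul (mul_le_mul (hlog p hp) (hlog q hq) (hlog0 q hq) (by linarith))
          (hpair p hp q hq) (norm_nonneg _) (by positivity)
    _ ≤ ∑ p ∈ s, L * L * ((b - a) + N / (δ * X) * (6 * L)) := by
        refine Finset.sum_le_sum fun p hp => ?_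
        rw [← Finset.mul_sum, Finset.sum_add_distrib, ← Finset.mul_sum, Finset.sum_ite_eq,
          if_pos hp]
        gcongr
        exact hrow p hp
    _ = s.card * (L * L * ((b - a) + N / (δ * X) * (6 * L))) := by
        rw [Finset.sum_const, nsmul_eq_mul]
    _ ≤ N * (L * L * ((b - a) + N / (δ * X) * (6 * L))) := by
        have : 0 ≤ b - a := sub_nonneg.mpr hab
        gcongr
    _ = (b - a) * N * L ^ 2 + 6 / δ * (N ^ 2 / X) * L ^ 3 := by
        field_simp
    _ ≤ (2 + 6 / δ) * ((b - a) * N + N ^ 2 / X) * L ^ 3 := by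
        have h0 : 0 ≤ (b - a) * N := mul_nonneg (sub_nonneg.mpr hab) hN0.le
        have h1 : (b - a) * N * L ^ 2 ≤ (b - a) * N * (2 * L ^ 3) := by
          gcongr
          nlinarith [sq_nonneg L]
        have h2 : 0 ≤ 6 / δ * ((b - a) * N) * L ^ 3 := by positivity
        have h3 : 0 ≤ 2 * (N ^ 2 / X) * L ^ 3 := by positivity
        linarith
    _ = _ := by rw [hNX]

theorem statement5 (k δ : ℝ) (hk : 1 < k) (hδ0 : 0 < δ) (hδ1 : δ < 1) :
    ∃ C > 0, ∀ X ≥ (2 : ℝ),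
      (∀ τ : ℝ, 0 < τ →
        (∫ α in (-τ)..τ, ‖S k δ X α‖ ^ 2) ≤
          C * (τ * X ^ (1 / k) + X ^ (2 / k - 1)) * (Real.log X) ^ 3) ∧
      (∀ n : ℤ,
        (∫ α in (n : ℝ)..((n : ℝ) + 1), ‖S k δ X α‖ ^ 2) ≤
          C * X ^ (1 / k) * (Real.log X) ^ 3) := by
  refine ⟨2 * (2 + 6 / δ), by positivity, fun X hX => ⟨fun τ hτ => ?_, fun n => ?_⟩⟩
  · have hL : 0 ≤ Real.log X := Real.log_nonneg (by linarith)
    have hX0 : 0 < X := by linarith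
    refine (integral_normSq_S_le hk hδ0 hX (by linarith : -τ ≤ τ)).trans ?_
    rw [mul_comm 2 (2 + 6 / δ), mul_assoc (2 + 6 / δ) 2]
    gcongr
    have := Real.rpow_pos_of_pos hX0 (2 / k - 1)
    linarith
  · have hL : 0 ≤ Real.log X := Real.log_nonneg (by linarith)
    refine (integral_normSq_S_le hk hδ0 hX (by linarith : (n : ℝ) ≤ n + 1)).trans ?_
    rw [mul_comm 2 (2 + 6 / δ), mul_assoc (2 + 6 / δ) 2]
    gcongr
    have h : X ^ (2 / k - 1) ≤ X ^ (1 / k) := by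
      refine Real.rpow_le_rpow_of_exponent_le (by linarith) ?_
      have : 1 / k ≤ 1 := by
        rw [div_le_one (by linarith)]
        exact hk.le
      have : 2 / k = 2 * (1 / k) := by ring
      linarith
    linarith

end
end

section
/- Let 0 < δ < 1. There is a constant C = C(δ) > 0 such that for all X ≥ 2, ∫_0^1 |S_2(α)|⁴ dα ≤ C X (log X)². -/
open scoped Classical
open MeasureTheory

noncomputable section

/-- An upper bound of Mertens type for `∑ log p / p`. -/
lemma sum_primesLE_log_div_le (n : ℕ) (hn : 1 ≤ n) :
    ∑ p ∈ Nat.primesLE n, Real.log p / p ≤ Real.log n + Real.log 4 := by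
  have hn0 : (0 : ℝ) < n := by exact_mod_cast hn
  have hdvd : ∏ p ∈ Nat.primesLE n, p ^ (n / p) ∣ n.factorial := by
    refine Finset.prod_dvd_of_isRelPrime ?_ ?_
    · intro p hp q hq hpq
      have hp' := (Nat.mem_primesLE.1 hp).2
      have hq' := (Nat.mem_primesLE.1 hq).2
      exact Nat.coprime_iff_isRelPrime.1 (Nat.Coprime.pow _ _ ((Nat.coprime_primes hp' hq').2 hpq))
    · intro p hp
      have hp' := (Nat.mem_primesLE.1 hp).2
      rw [hp'.pow_dvd_factorial_iff (b := Nat.log p n + 2) (by omega)]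
      have h1 : 1 ∈ Finset.Ico 1 (Nat.log p n + 2) := by simp
      simpa using Finset.single_le_sum (f := fun i => n / p ^ i) (fun i _ => Nat.zero_le _) h1
  have hle : ∑ p ∈ Nat.primesLE n, ((n / p : ℕ) : ℝ) * Real.log p ≤ n * Real.log n := by
    have h1 : (∏ p ∈ Nat.primesLE n, p ^ (n / p) : ℕ) ≤ n ^ n :=
      (Nat.le_of_dvd (Nat.factorial_pos n) hdvd).trans (Nat.factorial_le_pow n)
    have h2 : Real.log ((∏ p ∈ Nat.primesLE n, p ^ (n / p) : ℕ) : ℝ) ≤ Real.log ((n ^ n : ℕ) : ℝ) := by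
      refine Real.log_le_log ?_ (by exact_mod_cast h1)
      have : 0 < ∏ p ∈ Nat.primesLE n, p ^ (n / p) :=
        Finset.prod_pos fun p hp => pow_pos (Nat.mem_primesLE.1 hp).2.pos _
      exact_mod_cast this
    push_cast at h2
    rw [Real.log_pow, Real.log_prod] at h2
    · simpa [Real.log_pow] using h2
    · intro p hp
      have := (Nat.mem_primesLE.1 hp).2.pos
      positivity
  have hθ : ∑ p ∈ Nat.primesLE n, Real.log p ≤ Real.log 4 * n := by
    rw [← Chebyshev.theta_eq_sum_primesLE_log]
    exact Chebyshev.theta_le_log4_mul_x hn0.le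
  have hmain : n * ∑ p ∈ Nat.primesLE n, Real.log p / p ≤
      ∑ p ∈ Nat.primesLE n, ((n / p : ℕ) : ℝ) * Real.log p + ∑ p ∈ Nat.primesLE n, Real.log p := by
    rw [Finset.mul_sum, ← Finset.sum_add_distrib]
    refine Finset.sum_le_sum fun p hp => ?_
    have hp' := (Nat.mem_primesLE.1 hp).2
    have h1 : (n : ℝ) / p ≤ (n / p : ℕ) + 1 := by
      rw [div_le_iff₀ (by exact_mod_cast hp'.pos)]
      exact_mod_cast (Nat.lt_mul_div_succ n hp'.pos).le.trans_eq (mul_comm _ _)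
    have h2 : 0 ≤ Real.log p := Real.log_natCast_nonneg p
    calc (n : ℝ) * (Real.log p / p) = n / p * Real.log p := by ring
      _ ≤ ((n / p : ℕ) + 1) * Real.log p := by gcongr
      _ = _ := by ring
  have : n * ∑ p ∈ Nat.primesLE n, Real.log p / p ≤ n * (Real.log n + Real.log 4) := by linarith
  exact le_of_mul_le_mul_left this hn0

lemma sum_primesLE_inv_le (n : ℕ) (hn : 1 ≤ n) :
    ∑ p ∈ Nat.primesLE n, (p : ℝ)⁻¹ ≤ Real.log n / 4 + (Real.log 4 / 4 + 81) := by
  have h4 : (4 : ℝ) ≤ Real.log 81 := by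
    rw [Real.le_log_iff_exp_le (by norm_num)]
    have : Real.exp 4 = Real.exp 1 ^ 4 := by rw [← Real.exp_nat_mul]; norm_num
    rw [this]
    calc Real.exp 1 ^ 4 ≤ 3 ^ 4 := by
          gcongr
          exact (Real.exp_one_lt_d9.trans (by norm_num)).le
      _ = 81 := by norm_num
  have hterm : ∀ p ∈ Nat.primesLE n, (p : ℝ)⁻¹ ≤ Real.log p / p / 4 + if p < 81 then 1 else 0 := by
    intro p hp
    have hp' := (Nat.mem_primesLE.1 hp).2
    have hp1 : (1 : ℝ) ≤ p := by exact_mod_cast hp'.one_le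
    have h0 : 0 ≤ Real.log p := Real.log_natCast_nonneg p
    split_ifs with h
    · have : (p : ℝ)⁻¹ ≤ 1 := inv_le_one_of_one_le₀ hp1
      have : 0 ≤ Real.log p / p / 4 := by positivity
      linarith
    · have : Real.log 81 ≤ Real.log p := Real.log_le_log (by norm_num) (by exact_mod_cast not_lt.1 h)
      rw [add_zero, div_div, le_div_iff₀ (by positivity)]
      field_simp
      linarith
  have hcard : ∑ p ∈ Nat.primesLE n, (if p < 81 then (1 : ℝ) else 0) ≤ 81 := by
    rw [← Finset.sum_filter, Finset.sum_const, nsmul_eq_mul, mul_one]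
    have : ((Nat.primesLE n).filter (· < 81)).card ≤ (Finset.range 81).card :=
      Finset.card_le_card fun p hp => by simpa using (Finset.mem_filter.1 hp).2
    exact_mod_cast this
  have := Finset.sum_le_sum hterm
  rw [Finset.sum_add_distrib, ← Finset.sum_div] at this
  linarith [sum_primesLE_log_div_le n hn]

lemma sum_inv_mul_pred_le (s : Finset ℕ) (hs : ∀ p ∈ s, 2 ≤ p) :
    ∑ p ∈ s, ((p : ℝ) * (p - 1))⁻¹ ≤ 1 := by
  obtain ⟨N, hN⟩ := s.exists_nat_subset_range
  have hsub : s ⊆ Finset.Ico 2 (N + 2) := fun p hp => by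
    have := Finset.mem_range.1 (hN hp)
    simp [hs p hp]; omega
  have hN' : ∀ N : ℕ, ∑ p ∈ Finset.Ico 2 (N + 2), ((p : ℝ) * (p - 1))⁻¹ = 1 - 1 / (N + 1) := by
    intro N
    induction N with
    | zero => simp
    | succ N ih =>
      rw [show N + 1 + 2 = (N + 2) + 1 by ring, Finset.sum_Ico_succ_top (by omega), ih]
      push_cast
      have : (N : ℝ) + 2 - 1 ≠ 0 := by have : (0:ℝ) ≤ N := N.cast_nonneg; linarith
      field_simp
      ring
  calc _ ≤ ∑ p ∈ Finset.Ico 2 (N + 2), ((p : ℝ) * (p - 1))⁻¹ := by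
        refine Finset.sum_le_sum_of_subset_of_nonneg hsub fun p hp _ => ?_
        have : (2 : ℝ) ≤ p := by exact_mod_cast (Finset.mem_Ico.1 hp).1
        have : (0 : ℝ) ≤ p - 1 := by linarith
        positivity
    _ = 1 - 1 / (N + 1) := hN' N
    _ ≤ 1 := by
        have : (0 : ℝ) ≤ 1 / (N + 1) := by positivity
        linarith

lemma prod_one_sub_inv_primeFactors (D : ℕ) (hD : D ≠ 0) :
    ∏ p ∈ D.primeFactors, (1 - (p : ℝ)⁻¹)⁻¹ = D / D.totient := by
  have h := Nat.totient_eq_mul_prod_factors D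
  have h' : (D.totient : ℝ) = D * ∏ p ∈ D.primeFactors, (1 - (p : ℝ)⁻¹) := by
    have := congrArg (Rat.cast : ℚ → ℝ) h
    push_cast at this
    exact this
  have hφ : (D.totient : ℝ) ≠ 0 := by
    have := Nat.totient_pos.2 (Nat.pos_of_ne_zero hD)
    positivity
  have hP : ∏ p ∈ D.primeFactors, (1 - (p : ℝ)⁻¹) ≠ 0 := fun h0 => hφ (by rw [h', h0, mul_zero])
  have : (D : ℝ) ≠ 0 := by exact_mod_cast hD
  rw [Finset.prod_inv_distrib, h']
  field_simp

lemma exists_div_totient_pow_le :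
    ∃ C > 0, ∀ D : ℕ, 1 ≤ D → ((D : ℝ) / D.totient) ^ 4 ≤ C * (1 + Real.log D) := by
  refine ⟨2 * Real.exp (4 * (Real.log 4 / 4 + 83)), by positivity, fun D hD => ?_⟩
  set y := Nat.log 2 D + 1 with hy
  have hy0 : (0 : ℝ) < y := by positivity
  have hprime : ∀ p ∈ D.primeFactors, p.Prime := fun p hp => Nat.prime_of_mem_primeFactors hp
  have hcard : D.primeFactors.card ≤ y := by
    have : 2 ^ D.primeFactors.card ≤ D :=
      calc 2 ^ D.primeFactors.card = ∏ p ∈ D.primeFactors, 2 := by simp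
        _ ≤ ∏ p ∈ D.primeFactors, p := Finset.prod_le_prod' fun p hp => (hprime p hp).two_le
        _ ≤ D := Nat.le_of_dvd hD (Nat.prod_primeFactors_dvd D)
    have := (Nat.le_log_iff_pow_le (by norm_num) (by omega)).2 this
    omega
  have hsum : ∑ p ∈ D.primeFactors, (p : ℝ)⁻¹ ≤ Real.log y / 4 + (Real.log 4 / 4 + 82) := by
    have hterm : ∀ p ∈ D.primeFactors, (p : ℝ)⁻¹ ≤ (if p ≤ y then (p : ℝ)⁻¹ else 0) + (y : ℝ)⁻¹ := by
      intro p hp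
      split_ifs with h
      · have : (0 : ℝ) ≤ (y : ℝ)⁻¹ := by positivity
        linarith
      · rw [zero_add]
        gcongr
        omega
    have h1 := Finset.sum_le_sum hterm
    rw [Finset.sum_add_distrib, ← Finset.sum_filter, Finset.sum_const, nsmul_eq_mul] at h1
    have h2 : ∑ p ∈ D.primeFactors with p ≤ y, (p : ℝ)⁻¹ ≤ ∑ p ∈ Nat.primesLE y, (p : ℝ)⁻¹ := by
      refine Finset.sum_le_sum_of_subset_of_nonneg (fun p hp => ?_) fun _ _ _ => by positivity
      rw [Finset.mem_filter] at hp
      exact Nat.mem_primesLE.2 ⟨hp.2, hprime p hp.1⟩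
    have h3 : (D.primeFactors.card : ℝ) * (y : ℝ)⁻¹ ≤ 1 := by
      rw [← div_eq_mul_inv, div_le_one hy0]
      exact_mod_cast hcard
    linarith [sum_primesLE_inv_le y (by omega)]
  have hprod : (D : ℝ) / D.totient ≤ Real.exp (Real.log y / 4 + (Real.log 4 / 4 + 83)) := by
    rw [← prod_one_sub_inv_primeFactors D (by omega)]
    calc ∏ p ∈ D.primeFactors, (1 - (p : ℝ)⁻¹)⁻¹
        ≤ ∏ p ∈ D.primeFactors, Real.exp ((p : ℝ)⁻¹ + ((p : ℝ) * (p - 1))⁻¹) := by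
          refine Finset.prod_le_prod (fun p hp => ?_) fun p hp => ?_
          · have : (p : ℝ)⁻¹ ≤ 1 := inv_le_one_of_one_le₀ (by exact_mod_cast (hprime p hp).one_le)
            exact inv_nonneg.2 (by linarith)
          · have h2 : (2 : ℝ) ≤ p := by exact_mod_cast (hprime p hp).two_le
            have h3 : (p : ℝ) - 1 ≠ 0 := by linarith
            have : (1 - (p : ℝ)⁻¹)⁻¹ = (p : ℝ)⁻¹ + ((p : ℝ) * (p - 1))⁻¹ + 1 := by
              have : (p : ℝ) ≠ 0 := by linarith
              field_simp
              ring
            rw [this]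
            exact Real.add_one_le_exp _
      _ = Real.exp (∑ p ∈ D.primeFactors, (p : ℝ)⁻¹ + ∑ p ∈ D.primeFactors, ((p : ℝ) * (p - 1))⁻¹) := by
          rw [← Finset.sum_add_distrib, Real.exp_sum]
      _ ≤ _ := by
          refine Real.exp_le_exp.2 ?_
          linarith [sum_inv_mul_pred_le D.primeFactors fun p hp => (hprime p hp).two_le]
  have hy2 : (y : ℝ) ≤ 2 * (1 + Real.log D) := by
    have h1 : (2 : ℝ) ^ Nat.log 2 D ≤ D := by exact_mod_cast Nat.pow_log_le_self 2 (by omega)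
    have h2 := Real.log_le_log (by positivity) h1
    rw [Real.log_pow] at h2
    have h3 := Real.log_two_gt_d9
    have h4 : (0 : ℝ) ≤ Nat.log 2 D := by positivity
    rw [hy]
    push_cast
    nlinarith
  calc ((D : ℝ) / D.totient) ^ 4 ≤ Real.exp (Real.log y / 4 + (Real.log 4 / 4 + 83)) ^ 4 := by gcongr
    _ = y * Real.exp (4 * (Real.log 4 / 4 + 83)) := by
        rw [← Real.exp_nat_mul, Nat.cast_ofNat, mul_add, Real.exp_add, mul_div_cancel₀ _ (by norm_num),
          Real.exp_log hy0]
    _ ≤ 2 * (1 + Real.log D) * Real.exp (4 * (Real.log 4 / 4 + 83)) := by gcongr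
    _ = _ := by ring

lemma sum_inv_le_of_mem_factoredNumbers (D : ℕ) (hD : D ≠ 0) (F : Finset ℕ)
    (hF : ∀ n ∈ F, n ∈ Nat.factoredNumbers D.primeFactors) :
    ∑ n ∈ F, (n : ℝ)⁻¹ ≤ D / D.totient := by
  let f : ℕ →* ℝ :=
    { toFun := fun n => (n : ℝ)⁻¹
      map_one' := by simp
      map_mul' := fun a b => by push_cast; rw [mul_inv] }
  have h := EulerProduct.summable_and_hasSum_factoredNumbers_prod_filter_prime_geometric (f := f)
    (fun {p} hp => by
      have : (1 : ℝ) < p := by exact_mod_cast hp.one_lt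
      change ‖(p : ℝ)⁻¹‖ < 1
      rw [norm_inv, Real.norm_natCast]
      exact inv_lt_one_of_one_lt₀ this) D.primeFactors
  have hfilter : D.primeFactors.filter Nat.Prime = D.primeFactors :=
    Finset.filter_true_of_mem fun p hp => Nat.prime_of_mem_primeFactors hp
  rw [hfilter] at h
  rw [← prod_one_sub_inv_primeFactors D hD]
  have h2 := sum_le_hasSum (F.subtype (· ∈ Nat.factoredNumbers D.primeFactors))
    (fun n _ => by change (0 : ℝ) ≤ ((n : ℕ) : ℝ)⁻¹; positivity) h.2
  rw [Finset.sum_subtype_of_mem (fun n => f n) hF] at h2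
  exact h2

lemma log_le_sum_inv_totient (D R : ℕ) (hD : D ≠ 0) :
    (D.totient : ℝ) / D * Real.log (R + 1) ≤
      ∑ m ∈ Finset.Icc 1 R with Squarefree m ∧ Nat.Coprime m D, (m.totient : ℝ)⁻¹ := by
  set r : ℕ → ℕ := fun n => ∏ p ∈ n.primeFactors with ¬ p ∣ D, p with hr
  have hDφ : (0 : ℝ) < D.totient := by exact_mod_cast Nat.totient_pos.2 (Nat.pos_of_ne_zero hD)
  have hD0 : (0 : ℝ) < D := by exact_mod_cast Nat.pos_of_ne_zero hD
  have hprime : ∀ n : ℕ, ∀ p ∈ n.primeFactors.filter (fun p => ¬ p ∣ D), p.Prime := fun n p hp =>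
    Nat.prime_of_mem_primeFactors (Finset.mem_filter.1 hp).1
  have hrpf : ∀ n : ℕ, (r n).primeFactors = n.primeFactors.filter (fun p => ¬ p ∣ D) := fun n =>
    Nat.primeFactors_prod (hprime n)
  have hrdvd : ∀ n, r n ∣ n := fun n =>
    (Finset.prod_dvd_prod_of_subset _ _ _ (Finset.filter_subset _ _)).trans
      (Nat.prod_primeFactors_dvd n)
  have hrsq : ∀ n, Squarefree (r n) := fun n =>
    Finset.squarefree_prod_of_pairwise_isCoprime
      (fun p hp q hq hpq => Nat.coprime_iff_isRelPrime.1
        ((Nat.coprime_primes (hprime n p hp) (hprime n q hq)).2 hpq))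
      (fun p hp => (hprime n p hp).prime.squarefree)
  have hrcop : ∀ n, Nat.Coprime (r n) D := fun n =>
    Nat.Coprime.prod_left fun p hp =>
      ((hprime n p hp).coprime_iff_not_dvd).2 (Finset.mem_filter.1 hp).2
  have hlog : Real.log (R + 1) ≤ ∑ n ∈ Finset.Icc 1 R, (n : ℝ)⁻¹ := by
    have := log_add_one_le_harmonic R
    rw [harmonic_eq_sum_Icc] at this
    push_cast at this
    exact this
  have hmaps : ∀ n ∈ Finset.Icc 1 R,
      r n ∈ (Finset.Icc 1 R).filter (fun m => Squarefree m ∧ Nat.Coprime m D) := by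
    intro n hn
    rw [Finset.mem_Icc] at hn
    rw [Finset.mem_filter, Finset.mem_Icc]
    exact ⟨⟨Nat.pos_of_dvd_of_pos (hrdvd n) hn.1, (Nat.le_of_dvd hn.1 (hrdvd n)).trans hn.2⟩,
      hrsq n, hrcop n⟩
  have hfiber : ∀ m ∈ (Finset.Icc 1 R).filter (fun m => Squarefree m ∧ Nat.Coprime m D),
      ∑ n ∈ Finset.Icc 1 R with r n = m, (n : ℝ)⁻¹ ≤ D / D.totient * (m.totient : ℝ)⁻¹ := by
    intro m hm
    rw [Finset.mem_filter, Finset.mem_Icc] at hm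
    obtain ⟨⟨hm1, -⟩, -, hmD⟩ := hm
    have hm0 : (0 : ℝ) < m := by exact_mod_cast hm1
    have hmφ : (0 : ℝ) < m.totient := by exact_mod_cast Nat.totient_pos.2 hm1
    have hdvd : ∀ n ∈ (Finset.Icc 1 R).filter (fun n => r n = m), m ∣ n := fun n hn =>
      (Finset.mem_filter.1 hn).2 ▸ hrdvd n
    have hinj : Set.InjOn (fun n => n / m) ((Finset.Icc 1 R).filter (fun n => r n = m)) := by
      intro a ha b hb hab
      exact (Nat.div_left_inj (hdvd a ha) (hdvd b hb)).1 hab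
    have h1 : ∑ n ∈ Finset.Icc 1 R with r n = m, (n : ℝ)⁻¹ =
        (m : ℝ)⁻¹ * ∑ k ∈ ((Finset.Icc 1 R).filter (fun n => r n = m)).image (fun n => n / m),
          (k : ℝ)⁻¹ := by
      rw [Finset.sum_image hinj, Finset.mul_sum]
      refine Finset.sum_congr rfl fun n hn => ?_
      rw [Nat.cast_div (hdvd n hn) hm0.ne', ← mul_inv, mul_div_cancel₀ _ hm0.ne']
    have h2 := sum_inv_le_of_mem_factoredNumbers (m * D) (by positivity)
      (((Finset.Icc 1 R).filter (fun n => r n = m)).image (fun n => n / m)) (by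
        intro k hk
        rw [Finset.mem_image] at hk
        obtain ⟨n, hn, rfl⟩ := hk
        have hn' := Finset.mem_filter.1 hn
        have hn1 := (Finset.mem_Icc.1 hn'.1).1
        have hk0 : n / m ≠ 0 :=
          (Nat.div_pos (Nat.le_of_dvd hn1 (hdvd n hn)) hm1).ne'
        rw [Nat.mem_factoredNumbers_iff_primeFactors_subset]
        refine ⟨hk0, fun p hp => ?_⟩
        have hpp := Nat.prime_of_mem_primeFactors hp
        have hpn : p ∈ n.primeFactors :=
          Nat.primeFactors_mono (Nat.div_dvd_of_dvd (hdvd n hn)) (by omega) hp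
        rw [Nat.primeFactors_mul (by omega) hD, Finset.mem_union]
        by_cases hpD : p ∣ D
        · exact Or.inr (Nat.mem_primeFactors.2 ⟨hpp, hpD, hD⟩)
        · left
          rw [← hn'.2, hrpf]
          exact Finset.mem_filter.2 ⟨hpn, hpD⟩)
    rw [h1]
    calc _ ≤ (m : ℝ)⁻¹ * (((m * D : ℕ) : ℝ) / (m * D).totient) := by gcongr
      _ = D / D.totient * (m.totient : ℝ)⁻¹ := by
        rw [Nat.totient_mul hmD]
        push_cast
        field_simp
  have hsum : ∑ n ∈ Finset.Icc 1 R, (n : ℝ)⁻¹ ≤ D / D.totient *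
      ∑ m ∈ Finset.Icc 1 R with Squarefree m ∧ Nat.Coprime m D, (m.totient : ℝ)⁻¹ := by
    rw [← Finset.sum_fiberwise_of_maps_to hmaps, Finset.mul_sum]
    exact Finset.sum_le_sum hfiber
  calc (D.totient : ℝ) / D * Real.log (R + 1) ≤ D.totient / D * (D / D.totient *
      ∑ m ∈ Finset.Icc 1 R with Squarefree m ∧ Nat.Coprime m D, (m.totient : ℝ)⁻¹) := by
        gcongr
        exact hlog.trans hsum
    _ = _ := by field_simp

/-- The squarefree integers up to `Q` that are coprime to `B`. -/
def sieveModuli (B Q : ℕ) : Finset ℕ :=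
  (Finset.Icc 1 Q).filter (fun q => Squarefree q ∧ Nat.Coprime q B)

lemma mem_sieveModuli {B Q q : ℕ} :
    q ∈ sieveModuli B Q ↔ (1 ≤ q ∧ q ≤ Q) ∧ Squarefree q ∧ Nat.Coprime q B := by
  simp [sieveModuli]

lemma sum_divisors_pow_card_primeFactors {q : ℕ} (hq : Squarefree q) (k : ℝ) :
    ∑ d ∈ q.divisors, k ^ d.primeFactors.card = (k + 1) ^ q.primeFactors.card := by
  have h := (ArithmeticFunction.IsMultiplicative.prodPrimeFactors
    (fun _ => k)).prodPrimeFactors_one_add_of_squarefree hq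
  have h1 : ∀ d ∈ q.divisors, ArithmeticFunction.prodPrimeFactors (fun _ => k) d =
      k ^ d.primeFactors.card := by
    intro d hd
    rw [ArithmeticFunction.prodPrimeFactors_apply (Nat.pos_of_mem_divisors hd).ne',
      Finset.prod_const]
  have h2 : ∀ p ∈ q.primeFactors, 1 + ArithmeticFunction.prodPrimeFactors (fun _ => k) p = k + 1 := by
    intro p hp
    have hp' := Nat.prime_of_mem_primeFactors hp
    rw [ArithmeticFunction.prodPrimeFactors_apply hp'.ne_zero, hp'.primeFactors,
      Finset.prod_singleton, add_comm]
  rw [Finset.sum_congr rfl h1, Finset.prod_congr rfl h2, Finset.prod_const] at h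
  exact h.symm

lemma sum_sieveModuli_succ_ge (B R k : ℕ) :
    ∑ d ∈ sieveModuli B (R ^ k), ∑ m ∈ sieveModuli (B * d) R,
        (k : ℝ) ^ d.primeFactors.card / d.totient * (m.totient : ℝ)⁻¹ ≤
      ∑ q ∈ sieveModuli B (R ^ (k + 1)), ((k + 1 : ℕ) : ℝ) ^ q.primeFactors.card / q.totient := by
  have h1 : ∀ q ∈ sieveModuli B (R ^ (k + 1)),
      ((k + 1 : ℕ) : ℝ) ^ q.primeFactors.card / q.totient =
        ∑ d ∈ q.divisors, (k : ℝ) ^ d.primeFactors.card / q.totient := by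
    intro q hq
    rw [← Finset.sum_div, sum_divisors_pow_card_primeFactors (mem_sieveModuli.1 hq).2.1]
    push_cast
    rfl
  rw [Finset.sum_congr rfl h1, Finset.sum_sigma', Finset.sum_sigma']
  set Φ : (Σ _ : ℕ, ℕ) → (Σ _ : ℕ, ℕ) := fun x => ⟨x.1 * x.2, x.1⟩ with hΦ
  have hinj : Set.InjOn Φ ((sieveModuli B (R ^ k)).sigma fun d => sieveModuli (B * d) R) := by
    rintro ⟨d, m⟩ hx ⟨d', m'⟩ - h
    simp only [hΦ, Sigma.mk.injEq, heq_eq_eq] at h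
    obtain ⟨h1, rfl⟩ := h
    have hd : 1 ≤ d := (mem_sieveModuli.1 (Finset.mem_sigma.1 hx).1).1.1
    rw [Nat.eq_of_mul_eq_mul_left hd h1]
  have himg : ((sieveModuli B (R ^ k)).sigma fun d => sieveModuli (B * d) R).image Φ ⊆
      (sieveModuli B (R ^ (k + 1))).sigma fun q => q.divisors := by
    intro y hy
    rw [Finset.mem_image] at hy
    obtain ⟨⟨d, m⟩, hx, rfl⟩ := hy
    rw [Finset.mem_sigma] at hx
    obtain ⟨⟨hd1, hdR⟩, hds, hdB⟩ := mem_sieveModuli.1 hx.1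
    obtain ⟨⟨hm1, hmR⟩, hms, hmB⟩ := mem_sieveModuli.1 hx.2
    have hdm : Nat.Coprime d m := (Nat.Coprime.coprime_mul_left_right hmB).symm
    rw [Finset.mem_sigma]
    refine ⟨mem_sieveModuli.2 ⟨⟨Nat.mul_pos hd1 hm1, ?_⟩, ?_, ?_⟩, ?_⟩
    · rw [pow_succ]; exact Nat.mul_le_mul hdR hmR
    · exact (Nat.squarefree_mul hdm).2 ⟨hds, hms⟩
    · exact Nat.Coprime.mul_left hdB (Nat.Coprime.coprime_mul_right_right hmB)
    · exact Nat.mem_divisors.2 ⟨dvd_mul_right _ _, (Nat.mul_pos hd1 hm1).ne'⟩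
  refine le_trans (le_of_eq ?_) (Finset.sum_le_sum_of_subset_of_nonneg himg fun y _ _ => by positivity)
  rw [Finset.sum_image hinj]
  refine Finset.sum_congr rfl fun x hx => ?_
  rw [Finset.mem_sigma] at hx
  have hdm : Nat.Coprime x.1 x.2 :=
    (Nat.Coprime.coprime_mul_left_right (mem_sieveModuli.1 hx.2).2.2).symm
  simp only [hΦ]
  rw [Nat.totient_mul hdm]
  push_cast
  rw [div_mul_eq_div_div, div_eq_mul_inv _ (x.2.totient : ℝ)]

lemma pow_log_div_le_sum_sieveModuli (B R K : ℕ) (hB : B ≠ 0) (F : ℝ) (hF : 0 < F)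
    (hR : 1 ≤ R) (h : ∀ d, 1 ≤ d → d ≤ R ^ K → ((B * d : ℕ) : ℝ) / (B * d).totient ≤ F) :
    (Real.log (R + 1) / F) ^ K ≤
      ∑ q ∈ sieveModuli B (R ^ K), (K : ℝ) ^ q.primeFactors.card / q.totient := by
  have hlog : 0 ≤ Real.log (R + 1) / F := by
    have : 0 ≤ Real.log (R + 1) := Real.log_nonneg (by linarith [(Nat.cast_nonneg R : (0 : ℝ) ≤ R)])
    positivity
  have key : ∀ k ≤ K, (Real.log (R + 1) / F) ^ k ≤
      ∑ q ∈ sieveModuli B (R ^ k), (k : ℝ) ^ q.primeFactors.card / q.totient := by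
    intro k
    induction k with
    | zero =>
      intro _
      have h1 : 1 ∈ sieveModuli B (R ^ 0) := mem_sieveModuli.2 (by simp)
      have := Finset.single_le_sum
        (f := fun q : ℕ => ((0 : ℕ) : ℝ) ^ q.primeFactors.card / q.totient)
        (fun q _ => by positivity) h1
      simpa using this
    | succ k ih =>
      intro hk
      refine le_trans ?_ (sum_sieveModuli_succ_ge B R k)
      rw [pow_succ]
      calc _ ≤ (∑ q ∈ sieveModuli B (R ^ k), (k : ℝ) ^ q.primeFactors.card / q.totient) *
            (Real.log (R + 1) / F) := by
            gcongr
            exact ih (by omega)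
        _ ≤ _ := by
            rw [Finset.sum_mul]
            refine Finset.sum_le_sum fun d hd => ?_
            rw [← Finset.mul_sum]
            refine mul_le_mul_of_nonneg_left ?_ (by positivity)
            obtain ⟨⟨hd1, hdR⟩, -⟩ := mem_sieveModuli.1 hd
            have hBd : B * d ≠ 0 := mul_ne_zero hB (by omega)
            refine le_trans ?_ (log_le_sum_inv_totient (B * d) R hBd)
            have hle := h d hd1 (hdR.trans (Nat.pow_le_pow_right hR (by omega)))
            have h1 : F⁻¹ ≤ (B * d).totient / ((B * d : ℕ) : ℝ) := by
              rw [← inv_div]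
              refine inv_anti₀ ?_ hle
              have := Nat.totient_pos.2 (Nat.pos_of_ne_zero hBd)
              have := Nat.pos_of_ne_zero hBd
              positivity
            rw [div_eq_inv_mul]
            have : 0 ≤ Real.log (R + 1) :=
              Real.log_nonneg (by linarith [(Nat.cast_nonneg R : (0 : ℝ) ≤ R)])
            gcongr
  exact key K le_rfl

lemma sum_range_mul_of_periodic {m n : ℕ} (hmn : Nat.Coprime m n) (hm : 0 < m) (hn : 0 < n)
    {f g : ℕ → ℝ} (hf : Function.Periodic f m) (hg : Function.Periodic g n) :
    ∑ t ∈ Finset.range (m * n), f t * g t =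
      (∑ t ∈ Finset.range m, f t) * ∑ t ∈ Finset.range n, g t := by
  have hinj : Set.InjOn (fun t : ℕ => (t % m, t % n)) (Finset.range (m * n)) := by
    intro a ha b hb hab
    simp only [Prod.mk.injEq] at hab
    have h := (Nat.modEq_and_modEq_iff_modEq_mul hmn).1 hab
    rw [Finset.mem_coe, Finset.mem_range] at ha hb
    exact h.eq_of_lt_of_lt ha hb
  have himg : (Finset.range (m * n)).image (fun t : ℕ => (t % m, t % n)) =
      Finset.range m ×ˢ Finset.range n := by
    refine Finset.eq_of_subset_of_card_le (fun x hx => ?_) ?_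
    · obtain ⟨t, -, rfl⟩ := Finset.mem_image.1 hx
      simp [Nat.mod_lt _ hm, Nat.mod_lt _ hn]
    · rw [Finset.card_image_of_injOn hinj]
      simp
  rw [Finset.sum_mul_sum, ← Finset.sum_product', ← himg, Finset.sum_image hinj]
  refine Finset.sum_congr rfl fun t _ => ?_
  simp only
  rw [hf.map_mod_nat, hg.map_mod_nat]

lemma sum_range_prod_of_periodic (s : Finset ℕ) (hs : ∀ p ∈ s, p.Prime) (f : ℕ → ℕ → ℝ)
    (hf : ∀ p ∈ s, Function.Periodic (f p) p) :
    ∑ t ∈ Finset.range (∏ p ∈ s, p), ∏ p ∈ s, f p t = ∏ p ∈ s, ∑ t ∈ Finset.range p, f p t := by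
  induction s using Finset.induction_on with
  | empty => simp
  | insert p s hp ih =>
    have hs' : ∀ q ∈ s, q.Prime := fun q hq => hs q (Finset.mem_insert_of_mem hq)
    have hpp := hs p (Finset.mem_insert_self p s)
    rw [Finset.prod_insert hp, Finset.prod_insert hp,
      ← ih hs' fun q hq => hf q (Finset.mem_insert_of_mem hq)]
    simp_rw [Finset.prod_insert hp]
    refine sum_range_mul_of_periodic ?_ hpp.pos (Finset.prod_pos fun q hq => (hs' q hq).pos)
      (hf p (Finset.mem_insert_self p s)) ?_
    · refine Nat.Coprime.prod_right fun q hq => (Nat.coprime_primes hpp (hs' q hq)).2 ?_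
      rintro rfl
      exact hp hq
    · intro t
      refine Finset.prod_congr rfl fun q hq => ?_
      obtain ⟨k, hk⟩ := Finset.dvd_prod_of_mem (fun q => q) hq
      have := (hf q (Finset.mem_insert_of_mem hq)).nat_mul k t
      rw [hk, mul_comm]
      exact_mod_cast this

lemma sum_range_eq_of_periodic {m : ℕ} {f : ℕ → ℝ} (hf : Function.Periodic f m)
    (T : ℕ) :
    ∑ t ∈ Finset.range T, f t =
      (T / m : ℕ) * ∑ t ∈ Finset.range m, f t + ∑ t ∈ Finset.range (T % m), f t := by
  have h : ∀ k r : ℕ, ∑ t ∈ Finset.range (m * k + r), f t =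
      k * ∑ t ∈ Finset.range m, f t + ∑ t ∈ Finset.range r, f t := by
    intro k
    induction k with
    | zero => simp
    | succ k ih =>
      intro r
      rw [show m * (k + 1) + r = m + (m * k + r) by ring, Finset.sum_range_add]
      have : ∀ t ∈ Finset.range (m * k + r), f (m + t) = f t := fun t _ => by
        rw [add_comm]; exact hf t
      rw [Finset.sum_congr rfl this, ih]
      push_cast
      ring
  conv_lhs => rw [← Nat.div_add_mod T m]
  exact h _ _

lemma sum_range_natCast_zmod (p : ℕ) [NeZero p] (F : ZMod p → ℝ) :
    ∑ r ∈ Finset.range p, F (r : ZMod p) = ∑ x : ZMod p, F x := by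
  refine Finset.sum_nbij' (fun r => (r : ZMod p)) ZMod.val ?_ ?_ ?_ ?_ ?_
  · intro r _; exact Finset.mem_univ _
  · intro x _; exact Finset.mem_range.2 (ZMod.val_lt x)
  · intro r hr; exact ZMod.val_cast_of_lt (Finset.mem_range.1 hr)
  · intro x _; exact ZMod.natCast_zmod_val x
  · intro r _; rfl

/-- The function equal to `1` off the residue classes `Ω p`, with mean value zero modulo `p`. -/
def sieveChar (Ω : ∀ p : ℕ, Finset (ZMod p)) (p t : ℕ) : ℝ :=
  if (t : ZMod p) ∈ Ω p then -((p - 4) / 4) else 1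

/-- The weight `∏ 4 / (p - 4)` of a sieve modulus. -/
def sieveWeight (q : ℕ) : ℝ := ∏ p ∈ q.primeFactors, 4 / ((p : ℝ) - 4)

lemma sieveChar_periodic (Ω : ∀ p : ℕ, Finset (ZMod p)) (p : ℕ) :
    Function.Periodic (sieveChar Ω p) p := by
  intro t
  simp [sieveChar]

section Sieve

variable {Ω : ∀ p : ℕ, Finset (ZMod p)} {p : ℕ}

lemma five_le_of_card_eq_four (hp : p.Prime) (h : (Ω p).card = 4) : 5 ≤ p := by
  have : Fact p.Prime := ⟨hp⟩
  have h1 := Finset.card_le_univ (Ω p)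
  rw [h, ZMod.card] at h1
  have : p ≠ 4 := by rintro rfl; revert hp; norm_num
  omega

lemma sum_range_ite_mem (hp : p.Prime) (h : (Ω p).card = 4) (a b : ℝ) :
    ∑ t ∈ Finset.range p, (if (t : ZMod p) ∈ Ω p then a else b) = 4 * a + (p - 4) * b := by
  have : Fact p.Prime := ⟨hp⟩
  have h5 := five_le_of_card_eq_four hp h
  have hc : (Finset.univ.filter fun x => ¬ x ∈ Ω p).card = p - 4 := by
    rw [Finset.filter_not, Finset.filter_mem_eq_inter, Finset.univ_inter,
      Finset.card_univ_sdiff, h, ZMod.card]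
  have hc' : (Finset.univ.filter fun x => x ∈ Ω p).card = 4 := by
    rw [Finset.filter_mem_eq_inter, Finset.univ_inter, h]
  rw [sum_range_natCast_zmod p (fun x => if x ∈ Ω p then a else b), Finset.sum_ite,
    Finset.sum_const, Finset.sum_const, hc, hc', nsmul_eq_mul, nsmul_eq_mul,
    Nat.cast_sub (by omega)]
  push_cast
  ring

lemma sum_sieveChar (hp : p.Prime) (h : (Ω p).card = 4) :
    ∑ t ∈ Finset.range p, sieveChar Ω p t = 0 := by
  simp only [sieveChar]
  rw [sum_range_ite_mem hp h]
  ring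

lemma sum_sieveChar_sq (hp : p.Prime) (h : (Ω p).card = 4) :
    ∑ t ∈ Finset.range p, sieveChar Ω p t * sieveChar Ω p t = p * (4 / ((p : ℝ) - 4))⁻¹ := by
  have h2 : ∀ t ∈ Finset.range p, sieveChar Ω p t * sieveChar Ω p t =
      if (t : ZMod p) ∈ Ω p then (((p : ℝ) - 4) / 4) ^ 2 else 1 := by
    intro t _
    simp only [sieveChar]
    split_ifs <;> ring
  rw [Finset.sum_congr rfl h2, sum_range_ite_mem hp h, inv_div]
  ring

lemma sieveWeight_pos {q : ℕ} (hΩ : ∀ p ∈ q.primeFactors, (Ω p).card = 4) : 0 < sieveWeight q := by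
  refine Finset.prod_pos fun p hp => ?_
  have h5 : (5 : ℝ) ≤ p := by
    exact_mod_cast five_le_of_card_eq_four (Nat.prime_of_mem_primeFactors hp) (hΩ p hp)
  have : (0 : ℝ) < p - 4 := by linarith
  positivity

lemma abs_sieveWeight_mul_le {q : ℕ} (hq : Squarefree q)
    (hΩ : ∀ p ∈ q.primeFactors, (Ω p).card = 4) (t : ℕ) :
    |sieveWeight q * ∏ p ∈ q.primeFactors, sieveChar Ω p t| ≤ q := by
  rw [sieveWeight, ← Finset.prod_mul_distrib, Finset.abs_prod]
  conv_rhs => rw [← Nat.prod_primeFactors_of_squarefree hq]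
  push_cast
  refine Finset.prod_le_prod (fun _ _ => abs_nonneg _) fun p hp => ?_
  have h5 : (5 : ℝ) ≤ p := by
    exact_mod_cast five_le_of_card_eq_four (Nat.prime_of_mem_primeFactors hp) (hΩ p hp)
  have h4 : (0 : ℝ) < p - 4 := by linarith
  rw [sieveChar]
  split_ifs
  · have : 4 / ((p : ℝ) - 4) * -((p - 4) / 4) = -1 := by field_simp
    rw [this]
    rw [abs_neg, abs_one]
    linarith
  · rw [mul_one, abs_of_pos (by positivity), div_le_iff₀ h4]
    nlinarith

lemma sum_sieveChar_mul_le {q r : ℕ} (hq : Squarefree q) (hr : Squarefree r)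
    (hΩq : ∀ p ∈ q.primeFactors, (Ω p).card = 4) (hΩr : ∀ p ∈ r.primeFactors, (Ω p).card = 4)
    (T : ℕ) :
    ∑ t ∈ Finset.range T, (sieveWeight q * ∏ p ∈ q.primeFactors, sieveChar Ω p t) *
        (sieveWeight r * ∏ p ∈ r.primeFactors, sieveChar Ω p t) ≤
      (if q = r then T * sieveWeight q else 0) + ((q : ℝ) * r) ^ 2 := by
  set s := q.primeFactors ∪ r.primeFactors with hs
  have hsp : ∀ p ∈ s, p.Prime := fun p hp => by
    rcases Finset.mem_union.1 hp with h | h <;> exact Nat.prime_of_mem_primeFactors h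
  have hsΩ : ∀ p ∈ s, (Ω p).card = 4 := fun p hp => by
    rcases Finset.mem_union.1 hp with h | h
    exacts [hΩq p h, hΩr p h]
  set m := ∏ p ∈ s, p with hm
  have hm0 : 0 < m := Finset.prod_pos fun p hp => (hsp p hp).pos
  have hmle : m ≤ q * r := by
    conv_rhs => rw [← Nat.prod_primeFactors_of_squarefree hq,
      ← Nat.prod_primeFactors_of_squarefree hr]
    rw [← Finset.prod_union_inter]
    exact Nat.le_mul_of_pos_right _ (Finset.prod_pos fun p hp =>
      Nat.pos_of_mem_primeFactors (Finset.mem_inter.1 hp).1)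
  let f : ℕ → ℕ → ℝ := fun p t => (if p ∈ q.primeFactors then sieveChar Ω p t else 1) *
    (if p ∈ r.primeFactors then sieveChar Ω p t else 1)
  have hfper : ∀ p ∈ s, Function.Periodic (f p) p := by
    intro p _ t
    simp only [f, sieveChar_periodic Ω p t]
  have hprod : ∀ t, (∏ p ∈ q.primeFactors, sieveChar Ω p t) *
      ∏ p ∈ r.primeFactors, sieveChar Ω p t = ∏ p ∈ s, f p t := by
    intro t
    simp only [f]
    rw [Finset.prod_mul_distrib, Finset.prod_ite_mem, Finset.prod_ite_mem,
      Finset.inter_eq_right.2 Finset.subset_union_left,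
      Finset.inter_eq_right.2 Finset.subset_union_right]
  have hper : Function.Periodic (fun t => ∏ p ∈ s, f p t) m := by
    intro t
    refine Finset.prod_congr rfl fun p hp => ?_
    obtain ⟨k, hk⟩ := Finset.dvd_prod_of_mem (fun p => p) hp
    have := (hfper p hp).nat_mul k t
    rw [hm, hk, mul_comm]
    exact_mod_cast this
  have hrw : ∀ t, (sieveWeight q * ∏ p ∈ q.primeFactors, sieveChar Ω p t) *
        (sieveWeight r * ∏ p ∈ r.primeFactors, sieveChar Ω p t) =
      sieveWeight q * sieveWeight r * ∏ p ∈ s, f p t := by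
    intro t
    rw [← hprod]
    ring
  have hwq := sieveWeight_pos hΩq
  have hwr := sieveWeight_pos hΩr
  have htail : sieveWeight q * sieveWeight r * ∑ t ∈ Finset.range (T % m), ∏ p ∈ s, f p t ≤
      ((q : ℝ) * r) ^ 2 := by
    rw [Finset.mul_sum]
    calc _ ≤ ∑ t ∈ Finset.range (T % m), (q : ℝ) * r := by
          refine Finset.sum_le_sum fun t _ => ?_
          rw [← hrw]
          refine (le_abs_self _).trans ?_
          rw [abs_mul]
          exact mul_le_mul (abs_sieveWeight_mul_le hq hΩq t) (abs_sieveWeight_mul_le hr hΩr t)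
            (abs_nonneg _) (Nat.cast_nonneg _)
      _ = (T % m : ℕ) * ((q : ℝ) * r) := by simp
      _ ≤ ((q : ℝ) * r) * (q * r) := by
          gcongr
          exact_mod_cast (Nat.mod_lt T hm0).le.trans hmle
      _ = _ := by ring
  have hblock : sieveWeight q * sieveWeight r *
      ((T / m : ℕ) * ∑ t ∈ Finset.range m, ∏ p ∈ s, f p t) ≤
      if q = r then T * sieveWeight q else 0 := by
    rw [sum_range_prod_of_periodic s hsp f hfper]
    split_ifs with hqr
    · subst hqr
      have hs' : s = q.primeFactors := Finset.union_self _
      have h1 : ∏ p ∈ s, ∑ t ∈ Finset.range p, f p t = m * (sieveWeight q)⁻¹ := by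
        rw [hm, sieveWeight, ← Finset.prod_inv_distrib, ← hs', Nat.cast_prod,
          ← Finset.prod_mul_distrib]
        refine Finset.prod_congr rfl fun p hp => ?_
        rw [← sum_sieveChar_sq (hsp p hp) (hsΩ p hp)]
        refine Finset.sum_congr rfl fun t _ => ?_
        simp only [f]
        rw [if_pos (hs' ▸ hp)]
      rw [h1]
      have h2 : ((T / m : ℕ) : ℝ) * m ≤ T := by exact_mod_cast Nat.div_mul_le_self T m
      calc _ = ((T / m : ℕ) : ℝ) * m * sieveWeight q := by field_simp
        _ ≤ _ := by gcongr
    · have hne : q.primeFactors ≠ r.primeFactors := fun h => hqr (by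
        rw [← Nat.prod_primeFactors_of_squarefree hq, ← Nat.prod_primeFactors_of_squarefree hr, h])
      obtain ⟨p, hp⟩ : ∃ p, ¬ (p ∈ q.primeFactors ↔ p ∈ r.primeFactors) := by
        by_contra! h
        exact hne (Finset.ext h)
      have hps : p ∈ s := by rw [hs, Finset.mem_union]; tauto
      rw [Finset.prod_eq_zero hps]
      · simp
      · rw [← sum_sieveChar (hsp p hps) (hsΩ p hps)]
        refine Finset.sum_congr rfl fun t _ => ?_
        simp only [f]
        by_cases hpq : p ∈ q.primeFactors
        · have : p ∉ r.primeFactors := by tauto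
          simp only [hpq, this, if_true, if_false, mul_one]
        · have : p ∈ r.primeFactors := by tauto
          simp only [hpq, this, if_true, if_false, one_mul]
  simp_rw [hrw]
  rw [← Finset.mul_sum, sum_range_eq_of_periodic hper, mul_add]
  exact add_le_add hblock htail

/-- An upper bound sieve removing four residue classes modulo every prime `p ∤ B`. -/
lemma card_mul_sq_le_of_sieve (B Q T : ℕ) (hΩ : ∀ p : ℕ, p.Prime → ¬ p ∣ B → (Ω p).card = 4)
    (A : Finset ℕ) (hAT : A ⊆ Finset.range T)
    (hA : ∀ t ∈ A, ∀ p : ℕ, p.Prime → p ≤ Q → ¬ p ∣ B → (t : ZMod p) ∉ Ω p) :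
    (A.card : ℝ) * (∑ q ∈ sieveModuli B Q, sieveWeight q) ^ 2 ≤
      T * (∑ q ∈ sieveModuli B Q, sieveWeight q) + (Q : ℝ) ^ 6 := by
  have hnd : ∀ q ∈ sieveModuli B Q, ∀ p ∈ q.primeFactors, p.Prime ∧ p ≤ Q ∧ ¬ p ∣ B := by
    intro q hq p hp
    obtain ⟨⟨hq1, hqQ⟩, -, hqB⟩ := mem_sieveModuli.1 hq
    have hpp := Nat.prime_of_mem_primeFactors hp
    refine ⟨hpp, (Nat.le_of_mem_primeFactors hp).trans hqQ, fun hpB => ?_⟩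
    exact Nat.Prime.not_coprime_iff_dvd.2 ⟨p, hpp, Nat.dvd_of_mem_primeFactors hp, hpB⟩ hqB
  have hΩ' : ∀ q ∈ sieveModuli B Q, ∀ p ∈ q.primeFactors, (Ω p).card = 4 := fun q hq p hp =>
    hΩ p (hnd q hq p hp).1 (hnd q hq p hp).2.2
  set G : ℕ → ℝ := fun t =>
    ∑ q ∈ sieveModuli B Q, sieveWeight q * ∏ p ∈ q.primeFactors, sieveChar Ω p t with hG
  have hGA : ∀ t ∈ A, G t = ∑ q ∈ sieveModuli B Q, sieveWeight q := by
    intro t ht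
    refine Finset.sum_congr rfl fun q hq => ?_
    rw [Finset.prod_eq_one, mul_one]
    intro p hp
    obtain ⟨h1, h2, h3⟩ := hnd q hq p hp
    rw [sieveChar, if_neg (hA t ht p h1 h2 h3)]
  have h1 : (A.card : ℝ) * (∑ q ∈ sieveModuli B Q, sieveWeight q) ^ 2 ≤
      ∑ t ∈ Finset.range T, G t ^ 2 := by
    calc _ = ∑ t ∈ A, G t ^ 2 := by
          rw [Finset.sum_congr rfl fun t ht => congrArg (· ^ 2) (hGA t ht), Finset.sum_const,
            nsmul_eq_mul]
      _ ≤ _ := Finset.sum_le_sum_of_subset_of_nonneg hAT fun _ _ _ => sq_nonneg _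
  have h2 : ∑ t ∈ Finset.range T, G t ^ 2 = ∑ q ∈ sieveModuli B Q, ∑ r ∈ sieveModuli B Q,
      ∑ t ∈ Finset.range T, (sieveWeight q * ∏ p ∈ q.primeFactors, sieveChar Ω p t) *
        (sieveWeight r * ∏ p ∈ r.primeFactors, sieveChar Ω p t) := by
    simp_rw [hG, sq, Finset.sum_mul_sum]
    rw [Finset.sum_comm]
    refine Finset.sum_congr rfl fun q _ => ?_
    rw [Finset.sum_comm]
  refine h1.trans (h2.le.trans ?_)
  have hcard : ((sieveModuli B Q).card : ℝ) ≤ Q := by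
    have := Finset.card_filter_le (Finset.Icc 1 Q) (fun q => Squarefree q ∧ Nat.Coprime q B)
    rw [Nat.card_Icc, Nat.add_sub_cancel] at this
    exact_mod_cast this
  calc _ ≤ ∑ q ∈ sieveModuli B Q, ∑ r ∈ sieveModuli B Q,
        ((if q = r then T * sieveWeight q else 0) + (Q : ℝ) ^ 4) := by
        refine Finset.sum_le_sum fun q hq => Finset.sum_le_sum fun r hr => ?_
        have hq' := mem_sieveModuli.1 hq
        have hr' := mem_sieveModuli.1 hr
        refine (sum_sieveChar_mul_le hq'.2.1 hr'.2.1 (hΩ' q hq) (hΩ' r hr) T).trans ?_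
        have hqQ : (q : ℝ) ≤ Q := by exact_mod_cast hq'.1.2
        have hrQ : (r : ℝ) ≤ Q := by exact_mod_cast hr'.1.2
        have : ((q : ℝ) * r) ^ 2 ≤ (Q * Q) ^ 2 := by gcongr
        linarith [show ((Q : ℝ) * Q) ^ 2 = (Q : ℝ) ^ 4 by ring]
    _ = T * (∑ q ∈ sieveModuli B Q, sieveWeight q) +
        ((sieveModuli B Q).card : ℝ) * ((sieveModuli B Q).card * (Q : ℝ) ^ 4) := by
        simp_rw [Finset.sum_add_distrib, Finset.sum_ite_eq, Finset.sum_const, nsmul_eq_mul]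
        rw [Finset.mul_sum]
        congr 1
        exact Finset.sum_congr rfl fun q hq => if_pos hq
    _ ≤ T * (∑ q ∈ sieveModuli B Q, sieveWeight q) + (Q : ℝ) * (Q * (Q : ℝ) ^ 4) := by gcongr
    _ = _ := by ring

lemma pow_card_div_totient_le_sieveWeight {q : ℕ} (hq : Squarefree q)
    (hΩ : ∀ p ∈ q.primeFactors, (Ω p).card = 4) :
    (4 : ℝ) ^ q.primeFactors.card / q.totient ≤ sieveWeight q := by
  have h1 : (q.totient : ℝ) = ∏ p ∈ q.primeFactors, ((p : ℝ) - 1) := by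
    rw [Nat.totient_eq_prod_factorization hq.ne_zero, Finsupp.prod, Nat.support_factorization]
    push_cast
    refine Finset.prod_congr rfl fun p hp => ?_
    have hpp := Nat.prime_of_mem_primeFactors hp
    rw [Nat.factorization_eq_one_of_squarefree hq hpp (Nat.dvd_of_mem_primeFactors hp),
      Nat.cast_sub hpp.one_le]
    simp
  rw [h1, sieveWeight, ← Finset.prod_const, ← Finset.prod_div_distrib]
  refine Finset.prod_le_prod (fun p hp => ?_) fun p hp => ?_
  all_goals
    have h5 : (5 : ℝ) ≤ p := by
      exact_mod_cast five_le_of_card_eq_four (Nat.prime_of_mem_primeFactors hp) (hΩ p hp)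
    have h4 : (0 : ℝ) < p - 4 := by linarith
    have h3 : (0 : ℝ) < p - 1 := by linarith
  · positivity
  · gcongr
    norm_num

end Sieve

/-- The zeros modulo `p` of the product `(w t + u v) (w t - u v) (v t + u w) (v t - u w)`. -/
def formRoots (u v w p : ℕ) : Finset (ZMod p) :=
  {(u * v * (w : ZMod p)⁻¹ : ZMod p), -(u * v * (w : ZMod p)⁻¹),
    u * w * (v : ZMod p)⁻¹, -(u * w * (v : ZMod p)⁻¹)}

/-- The primes for which `formRoots` degenerates divide this number. -/
def badModulus (u v w : ℕ) : ℕ := 2 * u * v * w * ((v : ℤ) ^ 4 - (w : ℤ) ^ 4).natAbs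

lemma ne_zero_of_not_dvd_badModulus {u v w p : ℕ} (hp : p.Prime) (h : ¬ p ∣ badModulus u v w) :
    (2 : ZMod p) ≠ 0 ∧ (u : ZMod p) ≠ 0 ∧ (v : ZMod p) ≠ 0 ∧ (w : ZMod p) ≠ 0 ∧
      (v : ZMod p) ^ 4 - (w : ZMod p) ^ 4 ≠ 0 := by
  have h5 : (p : ℤ) ∣ (v : ℤ) ^ 4 - (w : ℤ) ^ 4 ↔ p ∣ ((v : ℤ) ^ 4 - (w : ℤ) ^ 4).natAbs :=
    Int.natCast_dvd
  have h2 := (ZMod.natCast_eq_zero_iff 2 p)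
  have h6 := ZMod.intCast_zmod_eq_zero_iff_dvd ((v : ℤ) ^ 4 - (w : ℤ) ^ 4) p
  push_cast at h2 h6
  rw [Ne, Ne, Ne, Ne, Ne, h2, h6, h5, ZMod.natCast_eq_zero_iff, ZMod.natCast_eq_zero_iff,
    ZMod.natCast_eq_zero_iff]
  rw [badModulus, hp.dvd_mul, hp.dvd_mul, hp.dvd_mul, hp.dvd_mul] at h
  tauto

lemma card_formRoots {u v w p : ℕ} (hp : p.Prime) (h : ¬ p ∣ badModulus u v w) :
    (formRoots u v w p).card = 4 := by
  have : Fact p.Prime := ⟨hp⟩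
  obtain ⟨h2, hu, hv, hw, h4⟩ := ne_zero_of_not_dvd_badModulus hp h
  have hvw : (v : ZMod p) ^ 2 ≠ (w : ZMod p) ^ 2 := fun h => h4 (by
    linear_combination ((v : ZMod p) ^ 2 + (w : ZMod p) ^ 2) * h)
  have hvw' : (v : ZMod p) ^ 2 ≠ -(w : ZMod p) ^ 2 := fun h => h4 (by
    linear_combination ((v : ZMod p) ^ 2 - (w : ZMod p) ^ 2) * h)
  set a : ZMod p := u * v * (w : ZMod p)⁻¹ with ha
  set b : ZMod p := u * w * (v : ZMod p)⁻¹ with hb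
  have haw : a * w = u * v := by rw [ha]; field_simp
  have hbv : b * v = u * w := by rw [hb]; field_simp
  have ha0 : a ≠ 0 := by
    intro h0
    rw [h0, zero_mul] at haw
    exact mul_ne_zero hu hv haw.symm
  have hb0 : b ≠ 0 := by
    intro h0
    rw [h0, zero_mul] at hbv
    exact mul_ne_zero hu hw hbv.symm
  have hab : a ≠ b := by
    intro hab
    refine hvw (mul_left_cancel₀ hu ?_)
    linear_combination -(v : ZMod p) * haw + (w : ZMod p) * hbv + (v : ZMod p) * w * hab
  have hab' : a ≠ -b := by
    intro hab
    refine hvw' (mul_left_cancel₀ hu ?_)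
    linear_combination -(v : ZMod p) * haw - (w : ZMod p) * hbv + (v : ZMod p) * w * hab
  have hneg : ∀ x : ZMod p, x ≠ 0 → x ≠ -x := fun x hx hxx =>
    mul_ne_zero h2 hx (by linear_combination hxx)
  rw [formRoots, ← ha, ← hb, Finset.card_insert_of_notMem, Finset.card_insert_of_notMem,
    Finset.card_insert_of_notMem, Finset.card_singleton]
  · simpa using hneg b hb0
  · simp only [Finset.mem_insert, Finset.mem_singleton, not_or]
    exact ⟨fun h => hab' (neg_eq_iff_eq_neg.1 h), fun h => hab (neg_injective h)⟩
  · simp only [Finset.mem_insert, Finset.mem_singleton, not_or]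
    exact ⟨hneg a ha0, hab, hab'⟩

/-- The `t ≤ N` for which `w t ± u v` and `v t ± u w` all lie in `P` up to sign. -/
def formSet (P : Finset ℕ) (N u v w : ℕ) : Finset ℕ :=
  (Finset.Icc 1 N).filter fun t : ℕ =>
    w * t + u * v ∈ P ∧ ((w * t : ℤ) - u * v).natAbs ∈ P ∧
      v * t + u * w ∈ P ∧ ((v * t : ℤ) - u * w).natAbs ∈ P

lemma notMem_formRoots {P : Finset ℕ} {Q N u v w t p : ℕ} (hP : ∀ q ∈ P, q.Prime ∧ Q < q)
    (ht : t ∈ formSet P N u v w) (hp : p.Prime) (hpQ : p ≤ Q) (h : ¬ p ∣ badModulus u v w) :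
    (t : ZMod p) ∉ formRoots u v w p := by
  have : Fact p.Prime := ⟨hp⟩
  obtain ⟨-, -, hv, hw, -⟩ := ne_zero_of_not_dvd_badModulus hp h
  have hdvd : ∀ q ∈ P, ¬ p ∣ q := fun q hq hpq => by
    have := (Nat.prime_dvd_prime_iff_eq hp (hP q hq).1).1 hpq
    have := (hP q hq).2
    omega
  obtain ⟨-, h1, h2, h3, h4⟩ := Finset.mem_filter.1 ht
  replace h1 := hdvd _ h1
  replace h2 := hdvd _ h2
  replace h3 := hdvd _ h3
  replace h4 := hdvd _ h4
  rw [← ZMod.natCast_eq_zero_iff] at h1 h3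
  rw [← Int.natCast_dvd, ← ZMod.intCast_zmod_eq_zero_iff_dvd] at h2 h4
  push_cast at h1 h2 h3 h4
  simp only [formRoots, Finset.mem_insert, Finset.mem_singleton, not_or]
  refine ⟨fun h => h2 ?_, fun h => h1 ?_, fun h => h4 ?_, fun h => h3 ?_⟩ <;>
    · rw [h]; field_simp; ring

lemma exists_card_formSet_mul_le : ∃ C > 0, ∀ (P : Finset ℕ) (M N R u v w : ℕ), 3 ≤ M →
    1 ≤ u → 1 ≤ v → 1 ≤ w → v ≠ w → u ≤ M → v ≤ M → w ≤ M → N ≤ M → 1 ≤ R → R ^ 24 ≤ N →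
    M < (R + 1) ^ 64 → (∀ q ∈ P, q.Prime ∧ R ^ 4 < q) →
    ((formSet P N u v w).card : ℝ) * Real.log M ^ 3 ≤ C * N := by
  obtain ⟨C, hC, hφ⟩ := exists_div_totient_pow_le
  refine ⟨3 * (10 * C * 64 ^ 4), by positivity, ?_⟩
  intro P M N R u v w hM hu hv hw hvw huM hvM hwM hNM hR hRN hMR hP
  set B := badModulus u v w with hBdef
  have hM1 : (1 : ℝ) ≤ Real.log M := by
    rw [Real.le_log_iff_exp_le (by positivity)]
    have : (3 : ℝ) ≤ M := by exact_mod_cast hM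
    linarith [Real.exp_one_lt_three]
  have hpow : (v : ℤ) ^ 4 - (w : ℤ) ^ 4 ≠ 0 := by
    rw [sub_ne_zero]
    intro h
    exact hvw (Nat.pow_left_injective (n := 4) (by norm_num) (by exact_mod_cast h))
  have hB0 : B ≠ 0 := by
    rw [hBdef, badModulus]
    have := Int.natAbs_ne_zero.2 hpow
    positivity
  have hBM : B ≤ 2 * M ^ 7 := by
    have h1 : ((v : ℤ) ^ 4 - (w : ℤ) ^ 4).natAbs ≤ M ^ 4 := by
      have h2 := Nat.pow_le_pow_left hvM 4
      have h3 := Nat.pow_le_pow_left hwM 4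
      have h4 : (v : ℤ) ^ 4 = (v ^ 4 : ℕ) := by push_cast; rfl
      have h5 : (w : ℤ) ^ 4 = (w ^ 4 : ℕ) := by push_cast; rfl
      rw [h4, h5]
      omega
    calc B ≤ 2 * M * M * M * M ^ 4 := by rw [hBdef, badModulus]; gcongr
      _ = 2 * M ^ 7 := by ring
  have hRM : R ^ 4 ≤ M := (Nat.pow_le_pow_right hR (by norm_num)).trans (hRN.trans hNM)
  set F : ℝ := Real.sqrt (Real.sqrt (10 * C * Real.log M)) with hF
  have hF0 : 0 < F := by positivity
  have hF4 : F ^ 4 = 10 * C * Real.log M := by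
    rw [show F ^ 4 = (F ^ 2) ^ 2 by ring, hF, Real.sq_sqrt (by positivity),
      Real.sq_sqrt (by positivity)]
  have hBd : ∀ d : ℕ, 1 ≤ d → d ≤ R ^ 4 → ((B * d : ℕ) : ℝ) / (B * d).totient ≤ F := by
    intro d hd hdR
    have hBd : 1 ≤ B * d := Nat.mul_pos (Nat.pos_of_ne_zero hB0) hd
    refine le_of_pow_le_pow_left₀ (n := 4) (by norm_num) hF0.le ?_
    rw [hF4]
    refine (hφ _ hBd).trans ?_
    have h1 : ((B * d : ℕ) : ℝ) ≤ M ^ 9 := by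
      have : B * d ≤ M ^ 9 :=
        calc B * d ≤ (2 * M ^ 7) * M := Nat.mul_le_mul hBM (hdR.trans hRM)
          _ ≤ (M * M ^ 7) * M := by gcongr; omega
          _ = M ^ 9 := by ring
      exact_mod_cast this
    have h2 : Real.log (B * d : ℕ) ≤ 9 * Real.log M := by
      have := Real.log_le_log (by exact_mod_cast hBd) h1
      rw [Real.log_pow] at this
      exact_mod_cast this
    calc C * (1 + Real.log (B * d : ℕ)) ≤ C * (10 * Real.log M) := by
          gcongr
          linarith
      _ = _ := by ring
  have hlow := pow_log_div_le_sum_sieveModuli B R 4 hB0 F hF0 hR hBd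
  have hcard : ∀ q : ℕ, Nat.Coprime q B → ∀ p ∈ q.primeFactors,
      (formRoots u v w p).card = 4 := fun q hq p hp => by
    have hpp := Nat.prime_of_mem_primeFactors hp
    refine card_formRoots hpp fun hpB => ?_
    exact hpp.one_lt.ne' (Nat.eq_one_of_dvd_coprimes hq (Nat.dvd_of_mem_primeFactors hp) hpB)
  set L : ℝ := ∑ q ∈ sieveModuli B (R ^ 4), sieveWeight q with hL
  have hL1 : 1 ≤ L := by
    have h1 : sieveWeight 1 = 1 := by simp [sieveWeight]
    rw [← h1, hL]
    refine Finset.single_le_sum (f := sieveWeight) (fun q hq => ?_) ?_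
    · exact (sieveWeight_pos (Ω := formRoots u v w) (hcard q (mem_sieveModuli.1 hq).2.2)).le
    · simp [mem_sieveModuli, Nat.one_le_pow _ _ hR]
  have hLlow : Real.log M ^ 3 ≤ (10 * C * 64 ^ 4) * L := by
    have h1 : (Real.log (R + 1) / F) ^ 4 ≤ L := by
      refine hlow.trans (Finset.sum_le_sum fun q hq => ?_)
      have hq' := mem_sieveModuli.1 hq
      exact_mod_cast pow_card_div_totient_le_sieveWeight (Ω := formRoots u v w) hq'.2.1
        (hcard q hq'.2.2)
    rw [div_pow, hF4, div_le_iff₀ (by positivity)] at h1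
    have h2 : Real.log M ≤ 64 * Real.log (R + 1) := by
      have : Real.log M ≤ Real.log ((R + 1 : ℝ) ^ 64) :=
        Real.log_le_log (by positivity) (by exact_mod_cast hMR.le)
      rwa [Real.log_pow] at this
    have h3 : Real.log M ^ 4 ≤ (64 * Real.log (R + 1)) ^ 4 := by gcongr
    refine le_of_mul_le_mul_right ?_ (by linarith : 0 < Real.log M)
    calc Real.log M ^ 3 * Real.log M = Real.log M ^ 4 := by ring
      _ ≤ 64 ^ 4 * Real.log (R + 1) ^ 4 := by rw [← mul_pow]; exact h3
      _ ≤ 64 ^ 4 * (L * (10 * C * Real.log M)) := by gcongr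
      _ = _ := by ring
  have hmain := card_mul_sq_le_of_sieve (Ω := formRoots u v w) B (R ^ 4) (N + 1)
    (fun p hp hpB => card_formRoots hp hpB) (formSet P N u v w)
    (fun t ht => by
      have := Finset.mem_Icc.1 (Finset.mem_filter.1 ht).1
      exact Finset.mem_range.2 (by omega))
    fun t ht p hp hpQ hpB => notMem_formRoots hP ht hp hpQ hpB
  have hN1 : (1 : ℝ) ≤ N := by exact_mod_cast (Nat.one_le_pow _ _ hR).trans hRN
  have hRN' : (((R ^ 4 : ℕ) : ℝ)) ^ 6 ≤ N := by
    rw [← Nat.cast_pow, ← pow_mul]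
    exact_mod_cast hRN
  rw [← hL] at hmain
  push_cast at hmain hRN'
  have h5 : ((formSet P N u v w).card : ℝ) * L ≤ 3 * N := by
    refine le_of_mul_le_mul_right ?_ (by linarith : 0 < L)
    calc ((formSet P N u v w).card : ℝ) * L * L = (formSet P N u v w).card * L ^ 2 := by ring
      _ ≤ (N + 1) * L + N := hmain.trans (by gcongr)
      _ ≤ (N + N) * L + N * L := by
        gcongr
        exact le_mul_of_one_le_right (by linarith) hL1
      _ = _ := by ring
  calc ((formSet P N u v w).card : ℝ) * Real.log M ^ 3
      ≤ (formSet P N u v w).card * ((10 * C * 64 ^ 4) * L) :=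
        mul_le_mul_of_nonneg_left hLlow (Nat.cast_nonneg _)
    _ = (10 * C * 64 ^ 4) * ((formSet P N u v w).card * L) := by ring
    _ ≤ (10 * C * 64 ^ 4) * (3 * N) := mul_le_mul_of_nonneg_left h5 (by positivity)
    _ = _ := by ring

lemma sum_inv_max_sq_le (s : ℕ) :
    ∑ v ∈ Finset.Icc 1 s, ∑ w ∈ Finset.Icc 1 s, (((max v w : ℕ) : ℝ) ^ 2)⁻¹ ≤
      2 * (1 + Real.log s) := by
  have h1 : ∀ w ∈ Finset.Icc 1 s,
      ∑ v ∈ Finset.Icc 1 s, (if v ≤ w then ((w : ℝ) ^ 2)⁻¹ else 0) = (w : ℝ)⁻¹ := by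
    intro w hw
    obtain ⟨hw1, hws⟩ := Finset.mem_Icc.1 hw
    have : (Finset.Icc 1 s).filter (· ≤ w) = Finset.Icc 1 w := by
      ext v
      simp only [Finset.mem_filter, Finset.mem_Icc]
      omega
    have hw0 : (w : ℝ) ≠ 0 := by positivity
    rw [← Finset.sum_filter, this, Finset.sum_const, Nat.card_Icc, Nat.add_sub_cancel,
      nsmul_eq_mul]
    field_simp
  have h2 : ∑ w ∈ Finset.Icc 1 s, (w : ℝ)⁻¹ ≤ 1 + Real.log s := by
    have := harmonic_le_one_add_log s
    rw [harmonic_eq_sum_Icc] at this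
    push_cast at this
    exact this
  calc ∑ v ∈ Finset.Icc 1 s, ∑ w ∈ Finset.Icc 1 s, (((max v w : ℕ) : ℝ) ^ 2)⁻¹
      ≤ ∑ v ∈ Finset.Icc 1 s, ∑ w ∈ Finset.Icc 1 s,
          ((if v ≤ w then ((w : ℝ) ^ 2)⁻¹ else 0) + if w ≤ v then ((v : ℝ) ^ 2)⁻¹ else 0) := by
        refine Finset.sum_le_sum fun v _ => Finset.sum_le_sum fun w _ => ?_
        rcases le_total v w with h | h
        · rw [max_eq_right h, if_pos h]
          exact le_add_of_nonneg_right (by split_ifs <;> positivity)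
        · rw [max_eq_left h, if_pos h]
          exact le_add_of_nonneg_left (by split_ifs <;> positivity)
    _ = ∑ w ∈ Finset.Icc 1 s, (w : ℝ)⁻¹ + ∑ v ∈ Finset.Icc 1 s, (v : ℝ)⁻¹ := by
        simp_rw [Finset.sum_add_distrib]
        rw [Finset.sum_congr rfl h1]
        congr 1
        rw [Finset.sum_comm]
        exact Finset.sum_congr rfl h1
    _ ≤ _ := by linarith

/-- The number of quadruples `(u, v, w, t)` for which `w t ± u v` and `v t ± u w` all lie in `P`
up to sign, over the ranges that arise from the equation `a² + b² = c² + d²`. -/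
def formCount (P : Finset ℕ) (M : ℕ) : ℕ :=
  ∑ v ∈ Finset.Icc 1 M.sqrt, ∑ w ∈ (Finset.Icc 1 M.sqrt).filter (· ≠ v),
    ∑ u ∈ Finset.Icc 1 (M / max v w), (formSet P (M / max v w) u v w).card

lemma exists_pow_le_lt_succ_pow {k M : ℕ} (hk : k ≠ 0) (hM : 1 ≤ M) :
    ∃ R : ℕ, 1 ≤ R ∧ R ^ k ≤ M ∧ M < (R + 1) ^ k := by
  have hex : ∃ n : ℕ, M < (n + 1) ^ k :=
    ⟨M, (Nat.lt_succ_self M).trans_le (Nat.le_self_pow hk _)⟩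
  have hne : Nat.find hex ≠ 0 := fun h0 => by
    have := Nat.find_spec hex
    rw [h0, zero_add, one_pow] at this
    omega
  refine ⟨Nat.find hex, by omega, ?_, Nat.find_spec hex⟩
  have := Nat.find_min hex (m := Nat.find hex - 1) (by omega)
  rwa [Nat.sub_add_cancel (by omega), not_lt] at this

lemma exists_formCount_mul_le : ∃ C > 0, ∀ (P : Finset ℕ) (M : ℕ), 3 ≤ M →
    (∀ q ∈ P, q.Prime ∧ M ≤ q ^ 2) → (formCount P M : ℝ) * Real.log M ^ 2 ≤ C * (M : ℝ) ^ 2 := by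
  obtain ⟨C, hC, h⟩ := exists_card_formSet_mul_le
  refine ⟨4 * C, by positivity, fun P M hM hP => ?_⟩
  have hlog : (1 : ℝ) ≤ Real.log M := by
    rw [Real.le_log_iff_exp_le (by positivity)]
    have : (3 : ℝ) ≤ M := by exact_mod_cast hM
    linarith [Real.exp_one_lt_three]
  obtain ⟨R, hR1, hRM, hMR⟩ := exists_pow_le_lt_succ_pow (k := 64) (by norm_num) (by omega : 1 ≤ M)
  have hPR : ∀ q ∈ P, q.Prime ∧ R ^ 4 < q := fun q hq => by
    refine ⟨(hP q hq).1, lt_of_not_ge fun hle => ?_⟩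
    have hq2 := (hP q hq).1.two_le
    have hR2 : 1 < R := by
      by_contra hR
      obtain rfl : R = 1 := by omega
      omega
    have h1 : q ^ 2 ≤ R ^ 8 := (Nat.pow_le_pow_left hle 2).trans (by rw [← pow_mul])
    have h2 : R ^ 8 < R ^ 64 := Nat.pow_lt_pow_right hR2 (by norm_num)
    have := (hP q hq).2
    omega
  have hsq : M.sqrt ≤ M := Nat.sqrt_le_self M
  have hterm : ∀ v ∈ Finset.Icc 1 M.sqrt, ∀ w ∈ (Finset.Icc 1 M.sqrt).filter (· ≠ v),
      (∑ u ∈ Finset.Icc 1 (M / max v w), ((formSet P (M / max v w) u v w).card : ℝ)) *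
        Real.log M ^ 3 ≤ C * (M : ℝ) ^ 2 * (((max v w : ℕ) : ℝ) ^ 2)⁻¹ := by
    intro v hv w hw
    obtain ⟨hw, hwv⟩ := Finset.mem_filter.1 hw
    obtain ⟨hv1, hvM⟩ := Finset.mem_Icc.1 hv
    obtain ⟨hw1, hwM⟩ := Finset.mem_Icc.1 hw
    have hm : max v w ≤ M.sqrt := max_le hvM hwM
    have hNM : M / max v w ≤ M := Nat.div_le_self _ _
    have hRN : R ^ 24 ≤ M / max v w := by
      calc R ^ 24 ≤ R ^ 32 := Nat.pow_le_pow_right hR1 (by norm_num)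
        _ ≤ M.sqrt := by rw [Nat.le_sqrt', ← pow_mul]; exact hRM
        _ ≤ M / max v w := by
          rw [Nat.le_div_iff_mul_le (by omega)]
          exact (Nat.mul_le_mul_left _ hm).trans (Nat.sqrt_le M)
    have hN : ((M / max v w : ℕ) : ℝ) ≤ M / (max v w : ℕ) := Nat.cast_div_le
    rw [Finset.sum_mul]
    calc ∑ u ∈ Finset.Icc 1 (M / max v w), ((formSet P (M / max v w) u v w).card : ℝ) *
          Real.log M ^ 3
        ≤ ∑ u ∈ Finset.Icc 1 (M / max v w), C * ((M / max v w : ℕ) : ℝ) := by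
          refine Finset.sum_le_sum fun u hu => ?_
          obtain ⟨hu1, huN⟩ := Finset.mem_Icc.1 hu
          exact h P M _ R u v w hM hu1 hv1 hw1 hwv.symm (huN.trans hNM) (hvM.trans hsq)
            (hwM.trans hsq) hNM hR1 hRN hMR hPR
      _ = C * ((M / max v w : ℕ) : ℝ) ^ 2 := by
          rw [Finset.sum_const, Nat.card_Icc, Nat.add_sub_cancel, nsmul_eq_mul]
          ring
      _ ≤ C * (M / (max v w : ℕ) : ℝ) ^ 2 :=
          mul_le_mul_of_nonneg_left (pow_le_pow_left₀ (Nat.cast_nonneg _) hN 2) hC.le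
      _ = _ := by rw [div_pow, div_eq_mul_inv, mul_assoc]
  clear hRM hMR
  have hmain : (formCount P M : ℝ) * Real.log M ^ 3 ≤ C * (M : ℝ) ^ 2 * (2 * (1 + Real.log M)) := by
    rw [formCount]
    push_cast
    simp_rw [Finset.sum_mul _ _ (Real.log (M : ℝ) ^ 3)]
    calc _ ≤ ∑ v ∈ Finset.Icc 1 M.sqrt, ∑ w ∈ (Finset.Icc 1 M.sqrt).filter (· ≠ v),
          C * (M : ℝ) ^ 2 * (((max v w : ℕ) : ℝ) ^ 2)⁻¹ := by
          refine Finset.sum_le_sum fun v hv => Finset.sum_le_sum fun w hw => ?_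
          rw [← Finset.sum_mul]
          exact hterm v hv w hw
      _ ≤ ∑ v ∈ Finset.Icc 1 M.sqrt, ∑ w ∈ Finset.Icc 1 M.sqrt,
          C * (M : ℝ) ^ 2 * (((max v w : ℕ) : ℝ) ^ 2)⁻¹ := by
          refine Finset.sum_le_sum fun v _ => ?_
          exact Finset.sum_le_sum_of_subset_of_nonneg (Finset.filter_subset _ _)
            fun w _ _ => by positivity
      _ ≤ C * (M : ℝ) ^ 2 * (2 * (1 + Real.log M.sqrt)) := by
          simp_rw [← Finset.mul_sum]
          exact mul_le_mul_of_nonneg_left (sum_inv_max_sq_le _) (by positivity)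
      _ ≤ _ := by
          have : Real.log M.sqrt ≤ Real.log M :=
            Real.log_le_log (by exact_mod_cast Nat.sqrt_pos.2 (by omega)) (by exact_mod_cast hsq)
          gcongr
  refine le_of_mul_le_mul_right ?_ (by linarith : 0 < Real.log M)
  calc (formCount P M : ℝ) * Real.log M ^ 2 * Real.log M
      = formCount P M * Real.log M ^ 3 := by ring
    _ ≤ C * (M : ℝ) ^ 2 * (2 * (1 + Real.log M)) := hmain
    _ ≤ C * (M : ℝ) ^ 2 * (2 * (Real.log M + Real.log M)) := by gcongr
    _ = _ := by ring

lemma exists_param_of_sq_add_sq_eq {p₁ p₂ p₃ p₄ : ℕ} (h₁ : Odd p₁) (h₂ : Odd p₂) (h₃ : Odd p₃)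
    (h₄ : Odd p₄) (h : p₁ ^ 2 + p₂ ^ 2 = p₃ ^ 2 + p₄ ^ 2) (h13 : p₃ < p₁) (h14 : p₁ ≠ p₄) :
    ∃ a b c d : ℕ, (1 ≤ a ∧ 1 ≤ b ∧ 1 ≤ c ∧ 1 ≤ d) ∧ b ≠ c ∧
      p₁ = c * d + a * b ∧ p₃ + a * b = c * d ∧ p₄ = b * d + a * c ∧ p₂ + a * c = b * d := by
  have h24 : p₂ < p₄ := by
    have := Nat.pow_lt_pow_left h13 (n := 2) (by norm_num)
    exact lt_of_pow_lt_pow_left₀ 2 (Nat.zero_le _) (by omega)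
  obtain ⟨m, rfl, hm⟩ : ∃ m, p₁ = p₃ + 2 * m ∧ 1 ≤ m := by
    obtain ⟨x, hx⟩ := h₁
    obtain ⟨y, hy⟩ := h₃
    exact ⟨x - y, by omega, by omega⟩
  obtain ⟨k, rfl, hk⟩ : ∃ k, p₄ = p₂ + 2 * k ∧ 1 ≤ k := by
    obtain ⟨x, hx⟩ := h₄
    obtain ⟨y, hy⟩ := h₂
    exact ⟨x - y, by omega, by omega⟩
  have heq : m * (p₃ + m) = k * (p₂ + k) := by nlinarith
  obtain ⟨b, c, hbc, hb, hc⟩ := Nat.exists_coprime m k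
  set a := Nat.gcd m k with ha
  have ha1 : 1 ≤ a := Nat.gcd_pos_of_pos_left _ hm
  have hb1 : 1 ≤ b := Nat.pos_of_ne_zero fun h0 => by simp [h0] at hb; omega
  have hc1 : 1 ≤ c := Nat.pos_of_ne_zero fun h0 => by simp [h0] at hc; omega
  have heq' : b * (p₃ + m) = c * (p₂ + k) := by
    refine Nat.eq_of_mul_eq_mul_left ha1 ?_
    calc a * (b * (p₃ + m)) = b * a * (p₃ + m) := by ring
      _ = c * a * (p₂ + k) := by rw [← hb, ← hc, heq]
      _ = _ := by ring
  obtain ⟨d, hd⟩ : b ∣ p₂ + k := hbc.dvd_of_dvd_mul_left ⟨_, heq'.symm⟩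
  have hd' : p₃ + m = c * d := by
    refine Nat.eq_of_mul_eq_mul_left hb1 ?_
    rw [heq', hd]
    ring
  have hd1 : 1 ≤ d := Nat.pos_of_ne_zero fun h0 => by simp [h0] at hd; omega
  have hb' : m = a * b := by rw [mul_comm]; exact hb
  have hc' : k = a * c := by rw [mul_comm]; exact hc
  refine ⟨a, b, c, d, ⟨ha1, hb1, hc1, hd1⟩, ?_, by omega, by omega, by omega, by omega⟩
  rintro rfl
  omega

/-- The solutions of `p₁² + p₂² = p₃² + p₄²` in `P`, apart from those with `{p₁, p₂} = {p₃, p₄}`. -/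
def offDiagonal (P : Finset ℕ) : Finset ((ℕ × ℕ) × ℕ × ℕ) :=
  ((P ×ˢ P) ×ˢ P ×ˢ P).filter fun x =>
    x.1.1 ^ 2 + x.1.2 ^ 2 = x.2.1 ^ 2 + x.2.2 ^ 2 ∧ x.1.1 ≠ x.2.1 ∧ x.1.1 ≠ x.2.2

lemma card_filter_offDiagonal_le {P : Finset ℕ} {M : ℕ} (hodd : ∀ p ∈ P, Odd p)
    (hPM : ∀ p ∈ P, p ≤ M) :
    ((offDiagonal P).filter fun x => x.2.1 < x.1.1).card ≤ 2 * formCount P M := by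
  set G : Finset (Σ _ : ℕ, Σ _ : ℕ, Σ _ : ℕ, ℕ) :=
    (Finset.Icc 1 M.sqrt).sigma fun v => ((Finset.Icc 1 M.sqrt).filter (· ≠ v)).sigma fun w =>
      (Finset.Icc 1 (M / max v w)).sigma fun u => formSet P (M / max v w) u v w with hG
  have hGcard : G.card = formCount P M := by
    rw [hG, formCount]
    simp only [Finset.card_sigma]
  let Φ : ℕ → ℕ → ℕ → ℕ → (ℕ × ℕ) × ℕ × ℕ := fun a b c d =>
    ((c * d + a * b, b * d - a * c), c * d - a * b, b * d + a * c)
  have hsub : (offDiagonal P).filter (fun x => x.2.1 < x.1.1) ⊆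
      G.image (fun y => Φ y.2.2.1 y.1 y.2.1 y.2.2.2) ∪
        G.image (fun y => Φ y.2.1 y.2.2.2 y.2.2.1 y.1) := by
    rintro ⟨⟨p₁, p₂⟩, p₃, p₄⟩ hx
    simp only [offDiagonal, Finset.mem_filter, Finset.mem_product] at hx
    obtain ⟨⟨⟨⟨hp1, hp2⟩, hp3, hp4⟩, heq, -, h14⟩, h13⟩ := hx
    obtain ⟨a, b, c, d, ⟨ha, hb, hc, hd⟩, hbc, e1, e3, e4, e2⟩ :=
      exists_param_of_sq_add_sq_eq (hodd _ hp1) (hodd _ hp2) (hodd _ hp3) (hodd _ hp4) heq h13 h14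
    have hM1 := hPM _ hp1
    have hM4 := hPM _ hp4
    have hcdM : c * d ≤ M := by omega
    have hbdM : b * d ≤ M := by omega
    have had : a < d := by
      have h0 := (hodd _ hp3).pos
      have h0' := (hodd _ hp2).pos
      rcases lt_or_gt_of_ne hbc with h | h
      · refine lt_of_mul_lt_mul_left (a := b) ?_ (Nat.zero_le _)
        have : a * b ≤ a * c := Nat.mul_le_mul_left _ h.le
        calc b * a = a * b := mul_comm _ _
          _ < b * d := by omega
      · refine lt_of_mul_lt_mul_left (a := c) ?_ (Nat.zero_le _)
        have : a * c ≤ a * b := Nat.mul_le_mul_left _ h.le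
        calc c * a = a * c := mul_comm _ _
          _ < c * d := by omega
    have e2' : p₂ = b * d - a * c := by omega
    have e3' : p₃ = c * d - a * b := by omega
    have z1 : (p₂ : ℤ) = b * d - a * c := by
      rw [eq_sub_iff_add_eq]
      exact_mod_cast e2
    have z2 : (p₃ : ℤ) = c * d - a * b := by
      rw [eq_sub_iff_add_eq]
      exact_mod_cast e3
    rw [Finset.mem_union, Finset.mem_image, Finset.mem_image]
    rcases le_or_gt (d ^ 2) M with hdM | hdM
    · right
      refine ⟨⟨d, a, c, b⟩, ?_, ?_⟩
      · have hd' : d ≤ M.sqrt := Nat.le_sqrt'.2 hdM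
        simp only [hG, Finset.mem_sigma, Finset.mem_filter, Finset.mem_Icc, formSet,
          max_eq_left had.le, Nat.le_div_iff_mul_le hd]
        refine ⟨⟨hd, hd'⟩, ⟨⟨ha, had.le.trans hd'⟩, had.ne⟩, ⟨hc, hcdM⟩, ⟨hb, hbdM⟩, ?_, ?_, ?_, ?_⟩
        · rwa [add_comm, ← e1]
        · rw [← Int.natAbs_neg, neg_sub, ← z2]
          exact hp3
        · rwa [mul_comm d b, mul_comm c a, ← e4]
        · rw [mul_comm (d : ℤ) b, mul_comm (c : ℤ) a, ← z1]
          exact hp2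
      · simp only [Φ, Prod.mk.injEq]
        exact ⟨⟨e1.symm, e2'.symm⟩, e3'.symm, e4.symm⟩
    · left
      refine ⟨⟨b, c, a, d⟩, ?_, ?_⟩
      · have hsqrt : ∀ x : ℕ, x * d ≤ M → x ≤ M.sqrt := fun x hx => by
          rw [Nat.le_sqrt']
          have hxd : x < d := lt_of_mul_lt_mul_right (a := d)
            (hx.trans_lt (by rwa [← sq])) (Nat.zero_le _)
          exact le_trans (by rw [sq]; exact Nat.mul_le_mul_left _ hxd.le) hx
        have hdN : d * max b c ≤ M := by
          rcases max_choice b c with h | h <;> rw [h, mul_comm] <;> assumption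
        have hm : 0 < max b c := lt_max_of_lt_left hb
        simp only [hG, Finset.mem_sigma, Finset.mem_filter, Finset.mem_Icc, formSet,
          Nat.le_div_iff_mul_le hm]
        refine ⟨⟨hb, hsqrt b hbdM⟩, ⟨⟨hc, hsqrt c hcdM⟩, hbc.symm⟩,
          ⟨ha, (Nat.mul_le_mul_right _ had.le).trans hdN⟩, ⟨hd, hdN⟩, ?_, ?_, ?_, ?_⟩
        · rwa [← e1]
        · rw [← z2]
          exact hp3
        · rwa [← e4]
        · rw [← z1]
          exact hp2
      · simp only [Φ, Prod.mk.injEq]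
        exact ⟨⟨e1.symm, e2'.symm⟩, e3'.symm, e4.symm⟩
  calc _ ≤ _ := Finset.card_le_card hsub
    _ ≤ G.card + G.card := (Finset.card_union_le _ _).trans
        (add_le_add Finset.card_image_le Finset.card_image_le)
    _ = _ := by rw [hGcard, two_mul]

lemma card_offDiagonal_le {P : Finset ℕ} {M : ℕ} (hodd : ∀ p ∈ P, Odd p)
    (hPM : ∀ p ∈ P, p ≤ M) : (offDiagonal P).card ≤ 4 * formCount P M := by
  have h1 := card_filter_offDiagonal_le hodd hPM
  have h2 : ((offDiagonal P).filter fun x => ¬ x.2.1 < x.1.1).card ≤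
      ((offDiagonal P).filter fun x => x.2.1 < x.1.1).card := by
    refine Finset.card_le_card_of_injOn Prod.swap (fun x hx => ?_) Prod.swap_injective.injOn
    simp only [offDiagonal, Finset.coe_filter, Finset.mem_filter, Finset.mem_product,
      Set.mem_ofPred_eq, Prod.fst_swap, Prod.snd_swap] at hx ⊢
    obtain ⟨⟨⟨h12, h34⟩, heq, h13, h14⟩, hlt⟩ := hx
    refine ⟨⟨⟨h34, h12⟩, heq.symm, h13.symm, fun h => h14 ?_⟩, by omega⟩
    rw [h] at heq
    exact Nat.pow_left_injective (n := 2) (by norm_num) (by simp only; omega)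
  have := Finset.card_filter_add_card_filter_not (s := offDiagonal P) (fun x => x.2.1 < x.1.1)
  omega

lemma integral_e_int_mul (n : ℤ) :
    ∫ α in (0 : ℝ)..1, e (n * α) = if n = 0 then 1 else 0 := by
  split_ifs with h
  · simp [h, e]
  · have hc : (2 * Real.pi * Complex.I * n : ℂ) ≠ 0 :=
      mul_ne_zero Complex.two_pi_I_ne_zero (Int.cast_ne_zero.2 h)
    have h1 : ∀ α : ℝ, e (n * α) = Complex.exp (2 * Real.pi * Complex.I * n * α) := fun α => by
      rw [e]
      push_cast
      ring_nf
    simp_rw [h1]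
    rw [integral_exp_mul_complex hc]
    have h2 : Complex.exp (2 * Real.pi * Complex.I * n * (1 : ℝ)) = 1 := by
      rw [← Complex.exp_int_mul_two_pi_mul_I n]
      congr 1
      push_cast
      ring
    rw [h2]
    simp

lemma conj_e (x : ℝ) : (starRingEnd ℂ) (e x) = e (-x) := by
  rw [e, e, ← Complex.exp_conj]
  congr 1
  simp [map_ofNat]

lemma e_add (x y : ℝ) : e (x + y) = e x * e y := by
  rw [e, e, e, ← Complex.exp_add]
  congr 1
  push_cast
  ring

lemma integral_norm_sum_pow_four (P : Finset ℕ) (f : ℕ → ℝ) :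
    ∫ α in (0 : ℝ)..1, ‖∑ p ∈ P, (f p : ℂ) * e ((p : ℝ) ^ (2 : ℝ) * α)‖ ^ 4 =
      ∑ x ∈ ((P ×ˢ P) ×ˢ P ×ˢ P).filter
          (fun x => x.1.1 ^ 2 + x.1.2 ^ 2 = x.2.1 ^ 2 + x.2.2 ^ 2),
        f x.1.1 * f x.1.2 * (f x.2.1 * f x.2.2) := by
  have hexp : ∀ α : ℝ, ((‖∑ p ∈ P, (f p : ℂ) * e ((p : ℝ) ^ (2 : ℝ) * α)‖ ^ 4 : ℝ) : ℂ) =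
      ∑ x ∈ (P ×ˢ P) ×ˢ P ×ˢ P, ((f x.1.1 * f x.1.2 * (f x.2.1 * f x.2.2) : ℝ) : ℂ) *
        e (((x.1.1 ^ 2 + x.1.2 ^ 2 - (x.2.1 ^ 2 + x.2.2 ^ 2) : ℤ) : ℝ) * α) := by
    intro α
    set z := ∑ p ∈ P, (f p : ℂ) * e ((p : ℝ) ^ (2 : ℝ) * α) with hz
    have hconj : (starRingEnd ℂ) z = ∑ p ∈ P, (f p : ℂ) * e (-((p : ℝ) ^ (2 : ℝ) * α)) := by
      rw [hz, map_sum]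
      refine Finset.sum_congr rfl fun p _ => ?_
      rw [map_mul, conj_e, Complex.conj_ofReal]
    have h4 : ((‖z‖ ^ 4 : ℝ) : ℂ) = z * z * ((starRingEnd ℂ) z * (starRingEnd ℂ) z) := by
      rw [mul_mul_mul_comm, Complex.mul_conj, Complex.normSq_eq_norm_sq]
      push_cast
      ring
    rw [h4, hconj, hz, Finset.sum_mul_sum, Finset.sum_mul_sum, ← Finset.sum_product',
      ← Finset.sum_product', Finset.sum_mul_sum, ← Finset.sum_product']
    refine Finset.sum_congr rfl fun x _ => ?_
    simp only [Real.rpow_two]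
    push_cast
    rw [show ((x.1.1 : ℝ) ^ 2 + (x.1.2 : ℝ) ^ 2 - ((x.2.1 : ℝ) ^ 2 + (x.2.2 : ℝ) ^ 2)) * α =
      ((x.1.1 : ℝ) ^ 2 * α + (x.1.2 : ℝ) ^ 2 * α) +
        (-((x.2.1 : ℝ) ^ 2 * α) + -((x.2.2 : ℝ) ^ 2 * α)) by ring, e_add, e_add, e_add]
    ring
  have hcont : ∀ n : ℝ, Continuous fun α : ℝ => e (n * α) := fun n => by
    unfold e
    fun_prop
  apply Complex.ofReal_injective
  rw [← intervalIntegral.integral_ofReal]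
  simp_rw [hexp]
  rw [intervalIntegral.integral_finsetSum fun x _ =>
    Continuous.intervalIntegrable (by have := hcont; fun_prop) _ _, Finset.sum_filter,
    Complex.ofReal_sum]
  refine Finset.sum_congr rfl fun x _ => ?_
  rw [intervalIntegral.integral_const_mul, integral_e_int_mul]
  by_cases h : x.1.1 ^ 2 + x.1.2 ^ 2 = x.2.1 ^ 2 + x.2.2 ^ 2
  · rw [if_pos h, if_pos (by rw [sub_eq_zero]; exact_mod_cast h), mul_one]
  · rw [if_neg h, if_neg (by rw [sub_eq_zero]; exact_mod_cast h), mul_zero, Complex.ofReal_zero]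

lemma sum_filter_sq_add_sq_le (P : Finset ℕ) (f : ℕ → ℝ) (c : ℝ)
    (hf : ∀ p ∈ P, 0 ≤ f p ∧ f p ≤ c) :
    ∑ x ∈ ((P ×ˢ P) ×ˢ P ×ˢ P).filter
        (fun x => x.1.1 ^ 2 + x.1.2 ^ 2 = x.2.1 ^ 2 + x.2.2 ^ 2),
      f x.1.1 * f x.1.2 * (f x.2.1 * f x.2.2) ≤
      (offDiagonal P).card * c ^ 4 + 2 * (∑ p ∈ P, f p ^ 2) ^ 2 := by
  set g : (ℕ × ℕ) × ℕ × ℕ → ℝ := fun x => f x.1.1 * f x.1.2 * (f x.2.1 * f x.2.2) with hg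
  set D₁ := (P ×ˢ P).image fun y => (y, y) with hD₁
  set D₂ := (P ×ˢ P).image fun y => (y, y.swap) with hD₂
  have hsub : ((P ×ˢ P) ×ˢ P ×ˢ P).filter
      (fun x => x.1.1 ^ 2 + x.1.2 ^ 2 = x.2.1 ^ 2 + x.2.2 ^ 2) ⊆ offDiagonal P ∪ (D₁ ∪ D₂) := by
    rintro ⟨⟨a, b⟩, c, d⟩ hx
    simp only [Finset.mem_filter, Finset.mem_product] at hx
    simp only [offDiagonal, hD₁, hD₂, Finset.mem_union, Finset.mem_filter, Finset.mem_product,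
      Finset.mem_image, Prod.exists, Prod.mk.injEq, Prod.swap_prod_mk]
    obtain ⟨⟨hab, hcd⟩, heq⟩ := hx
    have hinj := Nat.pow_left_injective (n := 2) (by norm_num)
    by_cases hac : a = c
    · have hbd : b = d := hinj (by subst hac; simp only; omega)
      exact Or.inr (Or.inl ⟨a, b, hab, ⟨rfl, rfl⟩, hac, hbd⟩)
    · by_cases had : a = d
      · have hbc : b = c := hinj (by subst had; simp only; omega)
        exact Or.inr (Or.inr ⟨a, b, hab, ⟨rfl, rfl⟩, hbc, had⟩)
      · exact Or.inl ⟨⟨hab, hcd⟩, heq, hac, had⟩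
  have hg0 : ∀ x ∈ offDiagonal P ∪ (D₁ ∪ D₂), 0 ≤ g x := by
    rintro ⟨⟨a, b⟩, c, d⟩ hx
    have hmem : (a ∈ P ∧ b ∈ P) ∧ c ∈ P ∧ d ∈ P := by
      simp only [offDiagonal, hD₁, hD₂, Finset.mem_union, Finset.mem_filter, Finset.mem_product,
        Finset.mem_image, Prod.exists, Prod.mk.injEq, Prod.swap_prod_mk] at hx
      rcases hx with hx | ⟨a', b', hx, ⟨rfl, rfl⟩, rfl, rfl⟩ | ⟨a', b', hx, ⟨rfl, rfl⟩, rfl, rfl⟩ <;>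
        tauto
    have h1 := (hf _ hmem.1.1).1
    have h2 := (hf _ hmem.1.2).1
    have h3 := (hf _ hmem.2.1).1
    have h4 := (hf _ hmem.2.2).1
    simp only [hg]
    positivity
  have hunion : ∀ s t : Finset ((ℕ × ℕ) × ℕ × ℕ), (∀ x ∈ s ∪ t, 0 ≤ g x) →
      ∑ x ∈ s ∪ t, g x ≤ ∑ x ∈ s, g x + ∑ x ∈ t, g x := fun s t h => by
    rw [← Finset.sum_union_inter]
    exact le_add_of_nonneg_right (Finset.sum_nonneg fun x hx =>
      h x (Finset.mem_union_left _ (Finset.mem_inter.1 hx).1))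
  have hoff : ∑ x ∈ offDiagonal P, g x ≤ (offDiagonal P).card * c ^ 4 := by
    rw [← nsmul_eq_mul]
    refine Finset.sum_le_card_nsmul _ _ _ ?_
    rintro ⟨⟨a, b⟩, c', d⟩ hx
    simp only [offDiagonal, Finset.mem_filter, Finset.mem_product] at hx
    obtain ⟨⟨⟨ha, hb⟩, hc, hd⟩, -⟩ := hx
    obtain ⟨a0, ac⟩ := hf _ ha
    obtain ⟨b0, bc⟩ := hf _ hb
    obtain ⟨c0, cc⟩ := hf _ hc
    obtain ⟨d0, dc⟩ := hf _ hd
    have hc0 : 0 ≤ c := a0.trans ac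
    calc f a * f b * (f c' * f d) ≤ c * c * (c * c) := by gcongr
      _ = c ^ 4 := by ring
  have hdiag : ∑ y ∈ P ×ˢ P, f y.1 * f y.2 * (f y.1 * f y.2) = (∑ p ∈ P, f p ^ 2) ^ 2 := by
    rw [sq, Finset.sum_mul_sum, ← Finset.sum_product']
    exact Finset.sum_congr rfl fun y _ => by ring
  have h1 : ∑ x ∈ D₁, g x = (∑ p ∈ P, f p ^ 2) ^ 2 := by
    rw [hD₁, Finset.sum_image (fun x _ y _ h => (Prod.mk.inj h).1), ← hdiag]
  have h2 : ∑ x ∈ D₂, g x = (∑ p ∈ P, f p ^ 2) ^ 2 := by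
    rw [hD₂, Finset.sum_image (fun x _ y _ h => (Prod.mk.inj h).1), ← hdiag]
    exact Finset.sum_congr rfl fun y _ => by simp only [hg, Prod.fst_swap, Prod.snd_swap]; ring
  calc _ ≤ ∑ x ∈ offDiagonal P ∪ (D₁ ∪ D₂), g x :=
        Finset.sum_le_sum_of_subset_of_nonneg hsub fun x hx _ => hg0 x hx
    _ ≤ ∑ x ∈ offDiagonal P, g x + (∑ x ∈ D₁, g x + ∑ x ∈ D₂, g x) :=
        (hunion _ _ hg0).trans (by
          gcongr
          exact hunion _ _ fun x hx => hg0 x (Finset.mem_union_right _ hx))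
    _ ≤ _ := by rw [h1, h2, two_mul]; gcongr

lemma exists_integral_norm_sum_pow_four_le : ∃ C > 0, ∀ (P : Finset ℕ) (M : ℕ), 3 ≤ M →
    (∀ q ∈ P, q.Prime ∧ q ≠ 2 ∧ q ≤ M ∧ M ≤ q ^ 2) →
    ∫ α in (0 : ℝ)..1, ‖∑ p ∈ P, (Real.log p : ℂ) * e ((p : ℝ) ^ (2 : ℝ) * α)‖ ^ 4 ≤
      C * (M : ℝ) ^ 2 * Real.log M ^ 2 := by
  obtain ⟨C, hC, h⟩ := exists_formCount_mul_le
  refine ⟨4 * C + 2 * Real.log 4 ^ 2, by positivity, fun P M hM hP => ?_⟩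
  have hlog : ∀ p ∈ P, 0 ≤ Real.log p ∧ Real.log p ≤ Real.log M := fun p hp => by
    have := (hP p hp).1.pos
    exact ⟨Real.log_natCast_nonneg p,
      Real.log_le_log (by exact_mod_cast this) (by exact_mod_cast (hP p hp).2.2.1)⟩
  have hM0 : 0 ≤ Real.log M := Real.log_natCast_nonneg M
  have hE : ((offDiagonal P).card : ℝ) ≤ 4 * formCount P M := by
    exact_mod_cast card_offDiagonal_le (fun p hp => (hP p hp).1.odd_of_ne_two (hP p hp).2.1)
      fun p hp => (hP p hp).2.2.1
  have hF := h P M hM fun q hq => ⟨(hP q hq).1, (hP q hq).2.2.2⟩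
  have hθ : ∑ p ∈ P, Real.log p ≤ Real.log 4 * M := by
    refine le_trans ?_ (Chebyshev.theta_le_log4_mul_x (Nat.cast_nonneg M))
    rw [Chebyshev.theta, Nat.floor_natCast]
    refine Finset.sum_le_sum_of_subset_of_nonneg (fun p hp => ?_)
      fun p _ _ => Real.log_natCast_nonneg p
    have := hP p hp
    exact Finset.mem_filter.2 ⟨Finset.mem_Ioc.2 ⟨this.1.pos, this.2.2.1⟩, this.1⟩
  have hsq : ∑ p ∈ P, Real.log p ^ 2 ≤ Real.log M * (Real.log 4 * M) := by
    calc ∑ p ∈ P, Real.log p ^ 2 ≤ ∑ p ∈ P, Real.log M * Real.log p := by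
          refine Finset.sum_le_sum fun p hp => ?_
          rw [sq]
          exact mul_le_mul_of_nonneg_right (hlog p hp).2 (hlog p hp).1
      _ = Real.log M * ∑ p ∈ P, Real.log p := by rw [Finset.mul_sum]
      _ ≤ _ := by gcongr
  rw [integral_norm_sum_pow_four P fun p => Real.log p]
  refine (sum_filter_sq_add_sq_le P (fun p => Real.log p) (Real.log M) hlog).trans ?_
  calc ((offDiagonal P).card : ℝ) * Real.log M ^ 4 + 2 * (∑ p ∈ P, Real.log p ^ 2) ^ 2
      ≤ 4 * formCount P M * Real.log M ^ 4 + 2 * (Real.log M * (Real.log 4 * M)) ^ 2 := by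
        gcongr
    _ = 4 * (formCount P M * Real.log M ^ 2) * Real.log M ^ 2 +
        2 * (Real.log M * (Real.log 4 * M)) ^ 2 := by ring
    _ ≤ 4 * (C * (M : ℝ) ^ 2) * Real.log M ^ 2 +
        2 * (Real.log M * (Real.log 4 * M)) ^ 2 := by gcongr
    _ = _ := by ring

lemma norm_S_le {k δ X Y : ℝ} (hX : X ≤ Y) (hY : 0 ≤ Y) (α : ℝ) : ‖S k δ X α‖ ≤ (Y + 2) ^ 2 := by
  have hceil : (⌈X⌉₊ : ℝ) ≤ Y + 1 :=
    (Nat.cast_le.2 (Nat.ceil_mono hX)).trans (Nat.ceil_lt_add_one hY).le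
  calc ‖S k δ X α‖ ≤ ∑ p ∈ (Finset.range (⌈X⌉₊ + 1)).filter
        (fun p : ℕ => p.Prime ∧ δ * X ≤ (p : ℝ) ^ k ∧ (p : ℝ) ^ k ≤ X), (Y + 2) := by
        refine norm_sum_le_of_le _ fun p hp => ?_
        have hp' : p ≤ ⌈X⌉₊ := Nat.lt_succ_iff.1 (Finset.mem_range.1 (Finset.mem_filter.1 hp).1)
        have he : ‖e ((p : ℝ) ^ k * α)‖ = 1 := by
          rw [e, Complex.norm_exp]
          simp
        rw [norm_mul, he, mul_one, Complex.norm_real, Real.norm_of_nonneg (Real.log_natCast_nonneg p)]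
        have h1 : (p : ℝ) ≤ Y + 1 := (Nat.cast_le.2 hp').trans hceil
        linarith [Real.log_le_self (Nat.cast_nonneg (α := ℝ) p)]
    _ ≤ (⌈X⌉₊ + 1 : ℕ) * (Y + 2) := by
        rw [Finset.sum_const, nsmul_eq_mul]
        refine mul_le_mul_of_nonneg_right ?_ (by linarith)
        exact_mod_cast (Finset.card_filter_le _ _).trans_eq (Finset.card_range _)
    _ ≤ (Y + 2) * (Y + 2) := by
        push_cast
        exact mul_le_mul_of_nonneg_right (by linarith) (by linarith)
    _ = _ := by ring

theorem statement6 (δ : ℝ) (hδ0 : 0 < δ) (hδ1 : δ < 1) :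
    ∃ C > 0, ∀ X ≥ (2 : ℝ),
      (∫ α in (0 : ℝ)..1, ‖S 2 δ X α‖ ^ 4) ≤ C * X * (Real.log X) ^ 2 := by
  obtain ⟨C, hC, h⟩ := exists_integral_norm_sum_pow_four_le
  set Y : ℝ := 9 / δ ^ 2 with hY
  have hY0 : 0 < Y := by positivity
  have hlog2 : 0 < Real.log 2 := Real.log_pos (by norm_num)
  refine ⟨C + ((Y + 2) ^ 2) ^ 4 / Real.log 2 ^ 2, by positivity, fun X hX => ?_⟩
  have hlogX : Real.log 2 ≤ Real.log X := Real.log_le_log (by norm_num) hX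
  rcases le_or_gt X Y with hXY | hXY
  · have h1 : ∫ α in (0 : ℝ)..1, ‖S 2 δ X α‖ ^ 4 ≤ ((Y + 2) ^ 2) ^ 4 := by
      have := intervalIntegral.norm_integral_le_of_norm_le_const (a := (0 : ℝ)) (b := 1)
        (f := fun α => ‖S 2 δ X α‖ ^ 4) (C := ((Y + 2) ^ 2) ^ 4) fun α _ => by
          rw [norm_pow, norm_norm]
          exact pow_le_pow_left₀ (norm_nonneg _) (norm_S_le hXY hY0.le α) 4
      simpa using (le_abs_self _).trans this
    calc _ ≤ ((Y + 2) ^ 2) ^ 4 / Real.log 2 ^ 2 * 1 * Real.log 2 ^ 2 := by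
          rw [mul_one, div_mul_cancel₀ _ (by positivity)]
          exact h1
      _ ≤ (C + ((Y + 2) ^ 2) ^ 4 / Real.log 2 ^ 2) * X * Real.log X ^ 2 := by
          gcongr
          · exact le_add_of_nonneg_left hC.le
          · linarith
  · have hX0 : 0 ≤ X := by linarith
    have hδX : 9 < δ ^ 2 * X := by rwa [hY, div_lt_iff₀' (by positivity)] at hXY
    have hδX' : 9 < δ * X := hδX.trans_le (by
      refine mul_le_mul_of_nonneg_right ?_ hX0
      nlinarith)
    have hX9 : 9 < X := hδX'.trans_le (by nlinarith)
    set M := ⌊Real.sqrt X⌋₊ with hM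
    have hMX : (M : ℝ) ≤ Real.sqrt X := Nat.floor_le (Real.sqrt_nonneg X)
    have hM3 : 3 ≤ M := Nat.le_floor (Real.le_sqrt_of_sq_le (by norm_num; linarith))
    have hMX2 : (M : ℝ) ^ 2 ≤ X := by
      rw [← Real.sq_sqrt hX0]
      gcongr
    have hsqrt : Real.sqrt X ≤ δ * X := by
      rw [Real.sqrt_le_left (by positivity)]
      nlinarith
    have hMlog : Real.log M ≤ Real.log X := by
      refine Real.log_le_log (by positivity) (hMX.trans (hsqrt.trans ?_))
      nlinarith
    refine (h _ M hM3 fun q hq => ?_).trans ?_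
    · obtain ⟨hqp, hq1, hq2⟩ := (Finset.mem_filter.1 hq).2
      rw [Real.rpow_two] at hq1 hq2
      refine ⟨hqp, ?_, Nat.le_floor (Real.le_sqrt_of_sq_le hq2), ?_⟩
      · rintro rfl
        norm_num at hq1
        linarith
      · exact_mod_cast (hMX.trans hsqrt).trans hq1
    · gcongr
      · exact le_add_of_nonneg_right (by positivity)

end
end
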